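/- arXiv:math/0608673 — 5 statements merged into one kernel-verified Lean document; each statement's English description precedes it below -/
import Mathlib

section
/- For g ≥ 2, the three tensors ω₁₂, ω₁₃, ω₁₄ form a basis of the subspace of H^{⊗4} consisting of tensors fixed by the diagonal action of every element of Sp(2g,ℚ). -/
/- Coordinate model of the symplectic vector space `H = ℚ^{2g}` and its tensor powers.
`I g` indexes the symplectic basis `x_1, …, x_g, y_1, …, y_g`;
`T g m` is the coordinate model of `H^{⊗ m}` (coordinates w.r.t. the basis tensors). -/

abbrev I (g : ℕ) := Fin g ⊕ Fin g
abbrev H (g : ℕ) := I g → ℚ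
abbrev T (g m : ℕ) := (Fin m → I g) → ℚ

/-- the basis vector `x_i` -/
def xB (g : ℕ) (i : Fin g) : H g := Pi.single (Sum.inl i) 1
/-- the basis vector `y_i` -/
def yB (g : ℕ) (i : Fin g) : H g := Pi.single (Sum.inr i) 1

/-- the symplectic intersection pairing `u · v` -/
def pairH (g : ℕ) (u v : H g) : ℚ :=
  ∑ i : Fin g, (u (Sum.inl i) * v (Sum.inr i) - u (Sum.inr i) * v (Sum.inl i))

/-- `D(ω₀) = (D ⊗ id + id ⊗ D)(ω₀)` for `ω₀ = Σᵢ (xᵢ ⊗ yᵢ - yᵢ ⊗ xᵢ)`. -/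
def Dom (g k : ℕ) (D : H g →ₗ[ℚ] T g (k+1)) : T g (k+2) := fun φ =>
  ∑ i : Fin g,
    (D (xB g i) (fun p => φ p.castSucc) * yB g i (φ (Fin.last (k+1)))
      + xB g i (φ 0) * D (yB g i) (fun p => φ p.succ)
      - D (yB g i) (fun p => φ p.castSucc) * xB g i (φ (Fin.last (k+1)))
      - yB g i (φ 0) * D (xB g i) (fun p => φ p.succ))

/-- `D* = Σᵢ (xᵢ ⊗ D(yᵢ) - yᵢ ⊗ D(xᵢ))`. -/
def dstar (g k : ℕ) (D : H g →ₗ[ℚ] T g (k+1)) : T g (k+2) := fun φ =>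
  ∑ i : Fin g,
    (xB g i (φ 0) * D (yB g i) (fun p => φ p.succ)
      - yB g i (φ 0) * D (xB g i) (fun p => φ p.succ))

/-- the cyclic permutation `σ_m : u₁ ⊗ ⋯ ⊗ u_m ↦ u₂ ⊗ ⋯ ⊗ u_m ⊗ u₁`. -/
def cyc (g m : ℕ) (t : T g m) : T g m := fun φ => t (φ ∘ (finRotate m).symm)

/-- the diagonal action of a linear map `A : H → H` on `H^{⊗m}` (in coordinates). -/
def actT (g m : ℕ) (A : H g →ₗ[ℚ] H g) (t : T g m) : T g m := fun ψ =>
  ∑ φ : Fin m → I g, t φ * ∏ q : Fin m, A (Pi.single (φ q) 1) (ψ q)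

/-- `A` is a symplectic automorphism, i.e. an element of `Sp(2g,ℚ)`. -/
def IsSp (g : ℕ) (A : H g ≃ₗ[ℚ] H g) : Prop :=
  ∀ u v : H g, pairH g (A u) (A v) = pairH g u v

/-- `ω₀` in coordinates -/
def om0 (g : ℕ) : T g 2 := fun φ =>
  ∑ i : Fin g, (xB g i (φ 0) * yB g i (φ 1) - yB g i (φ 0) * xB g i (φ 1))

/-- `ω₁₂ = ω₀ ⊗ ω₀` -/
def om12 (g : ℕ) : T g 4 := fun ψ => om0 g ![ψ 0, ψ 1] * om0 g ![ψ 2, ψ 3]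
/-- `ω₁₃ = ω₀ ⊗₁₃ ω₀`, the image of `ω₀ ⊗ ω₀` under `u₁⊗u₂⊗u₃⊗u₄ ↦ u₁⊗u₃⊗u₂⊗u₄` -/
def om13 (g : ℕ) : T g 4 := fun ψ => om0 g ![ψ 0, ψ 2] * om0 g ![ψ 1, ψ 3]
/-- `ω₁₄ = ω₀ ⊗₁₄ ω₀`, the image of `ω₀ ⊗ ω₀` under `u₁⊗u₂⊗u₃⊗u₄ ↦ u₁⊗u₃⊗u₄⊗u₂` -/
def om14 (g : ℕ) : T g 4 := fun ψ => om0 g ![ψ 0, ψ 3] * om0 g ![ψ 1, ψ 2]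

/-- The `Sp(2g)`-invariant four-index arrays, i.e. the coordinate functions of the
`Sp(2g,ℚ)`-invariant tensors in `H^{⊗4}`. -/
def invariantArrays (g : ℕ) : Submodule ℚ (I g → I g → I g → I g → ℚ) where
  carrier := {F | ∀ M ∈ Matrix.symplecticGroup (Fin g) ℚ, ∀ p q r s,
    ∑ a, M p a * ∑ b, M q b * ∑ c, M r c * ∑ d, M s d * F a b c d = F p q r s}
  add_mem' := by
    intro F G hF hG M hM p q r s
    simp only [Pi.add_apply, mul_add, Finset.sum_add_distrib, hF M hM, hG M hM]
  zero_mem' := by intro M hM p q r s; simp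
  smul_mem' := by
    intro k F hF M hM p q r s
    simp only [Pi.smul_apply, smul_eq_mul, mul_left_comm _ k, ← Finset.mul_sum, hF M hM]

namespace invariantArrays

variable {g : ℕ} {F : I g → I g → I g → I g → ℚ}

lemma swap_middle (hF : F ∈ invariantArrays g) :
    (fun a b c d => F a c b d) ∈ invariantArrays g := by
  intro M hM p q r s
  beta_reduce
  rw [← hF M hM p r q s]
  refine Finset.sum_congr rfl fun a _ => congrArg _ ?_
  simp only [Finset.mul_sum]
  rw [Finset.sum_comm]
  simp only [mul_left_comm (M q _) (M r _)]

lemma swap_last (hF : F ∈ invariantArrays g) :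
    (fun a b c d => F a b d c) ∈ invariantArrays g := by
  intro M hM p q r s
  beta_reduce
  rw [← hF M hM p q s r]
  refine Finset.sum_congr rfl fun a _ => congrArg _ (Finset.sum_congr rfl fun b _ => congrArg _ ?_)
  simp only [Finset.mul_sum]
  rw [Finset.sum_comm]
  simp only [mul_left_comm (M r _) (M s _)]

lemma J_mul_J_mem :
    (fun a b c d => Matrix.J (Fin g) ℚ a b * Matrix.J (Fin g) ℚ c d) ∈ invariantArrays g := by
  intro M hM p q r s
  have key : ∀ p q, ∑ a, ∑ b, M p a * (M q b * Matrix.J (Fin g) ℚ a b) =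
      Matrix.J (Fin g) ℚ p q := by
    intro p q
    have h := congrFun (congrFun (SymplecticGroup.mem_iff.1 hM) p) q
    rw [← h, Finset.sum_comm]
    simp only [Matrix.mul_apply, Matrix.transpose_apply, Finset.sum_mul]
    exact Finset.sum_congr rfl fun b _ => Finset.sum_congr rfl fun a _ => by ring
  beta_reduce
  rw [← key p q, Finset.sum_mul]
  refine Finset.sum_congr rfl fun a _ => ?_
  rw [Finset.sum_mul, Finset.mul_sum]
  refine Finset.sum_congr rfl fun b _ => ?_
  rw [← key r s]
  simp only [Finset.mul_sum]
  exact Finset.sum_congr rfl fun c _ => Finset.sum_congr rfl fun d _ => by ring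

/-- A signed or scaled permutation matrix with `e_a ↦ c a • e_{π a}`. -/
lemma monomial_apply (hF : F ∈ invariantArrays g) (π : Equiv.Perm (I g)) (k : I g → ℚ)
    (hk : ∀ a b, k a * k b * Matrix.J (Fin g) ℚ (π a) (π b) = Matrix.J (Fin g) ℚ a b)
    (a b c d : I g) :
    F (π a) (π b) (π c) (π d) = k a * (k b * (k c * (k d * F a b c d))) := by
  let M : Matrix (I g) (I g) ℚ := Matrix.of fun p a => if p = π a then k a else 0
  have hM : M ∈ Matrix.symplecticGroup (Fin g) ℚ := by
    rw [SymplecticGroup.mem_iff']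
    ext a b
    rw [← hk a b]
    simp [M, Matrix.mul_apply]
    ring
  rw [← hF M hM]
  simp [M]

lemma swap_indices (hF : F ∈ invariantArrays g) (i j : Fin g) (a b c d : I g) :
    let π : I g → I g := Sum.map (Equiv.swap i j) (Equiv.swap i j)
    F (π a) (π b) (π c) (π d) = F a b c d := by
  have h := monomial_apply hF (Equiv.sumCongr (Equiv.swap i j) (Equiv.swap i j)) (fun _ => 1)
    (by rintro (a | a) (b | b) <;> simp [Matrix.J, Matrix.one_apply]) a b c d
  simpa using h

/-- Invariance under `x_i ↦ y_i`, `y_i ↦ -x_i`. -/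
lemma flip_eq_zero (hF : F ∈ invariantArrays g) (i : Fin g) {a b c d : I g}
    (h0 : F a b c d = 0) :
    let π := Equiv.swap (Sum.inl i : I g) (Sum.inr i)
    F (π a) (π b) (π c) (π d) = 0 := by
  have h := monomial_apply hF (Equiv.swap (Sum.inl i) (Sum.inr i))
    (fun a => if a = Sum.inr i then -1 else 1)
    (by
      rintro (a | a) (b | b) <;> by_cases ha : a = i <;> by_cases hb : b = i <;>
        simp [Matrix.J, Matrix.one_apply, Equiv.swap_apply_def, ha, hb]
      all_goals grind) a b c d
  simp [h, h0]

/-- The factor by which the torus element `x_i ↦ 2 x_i`, `y_i ↦ y_i / 2` scales a basis vector. -/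
def torusFactor (i : Fin g) : I g → ℚ :=
  Sum.elim (fun j => if j = i then 2 else 1) (fun j => if j = i then 1 / 2 else 1)

lemma eq_zero_of_torusFactor (hF : F ∈ invariantArrays g) (i : Fin g) {a b c d : I g}
    (h : torusFactor i a * (torusFactor i b * (torusFactor i c * torusFactor i d)) ≠ 1) :
    F a b c d = 0 := by
  have h' := monomial_apply hF (Equiv.refl _) (torusFactor i)
    (by
      rintro (a | a) (b | b) <;> by_cases ha : a = i <;> by_cases hb : b = i <;>
        simp [Matrix.J, Matrix.one_apply, torusFactor, ha, hb]
      all_goals grind) a b c d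
  simp only [Equiv.refl_apply] at h'
  by_contra h0
  exact h (mul_right_cancel₀ h0 (by linarith))

/-- Invariance under `x_i ↦ x_i + x_j`, `y_j ↦ y_j - y_i`. -/
lemma apply_inl_inl_inr_inr_self (hF : F ∈ invariantArrays g) {i j : Fin g} (hij : i ≠ j)
    (h₁ : F (.inl i) (.inl j) (.inr i) (.inr j) = 0)
    (h₂ : F (.inl i) (.inl j) (.inr j) (.inr i) = 0) :
    F (.inl i) (.inl i) (.inr i) (.inr i) = 0 := by
  let M : Matrix (I g) (I g) ℚ :=
    Matrix.fromBlocks (Matrix.transvection j i 1) 0 0 (Matrix.transvection i j (-1))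
  have hM : M ∈ Matrix.symplecticGroup (Fin g) ℚ := by
    rw [SymplecticGroup.mem_iff]
    have ht : ∀ (i j : Fin g) (c : ℚ),
        (Matrix.transvection i j c).transpose = Matrix.transvection j i c := by
      simp [Matrix.transvection, Matrix.transpose_add]
    simp only [M, Matrix.J, Matrix.fromBlocks_transpose, Matrix.fromBlocks_multiply, ht]
    simp [Matrix.transvection_mul_transvection_same, hij, hij.symm]
  have row_inl_j : ∀ f : I g → ℚ, ∑ a, M (.inl j) a * f a = f (.inl j) + f (.inl i) := by
    intro f
    simp [M, Matrix.transvection, Matrix.one_apply, Matrix.single_apply, add_mul,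
      Finset.sum_add_distrib]
  have row_inl_i : ∀ f : I g → ℚ, ∑ a, M (.inl i) a * f a = f (.inl i) := by
    intro f
    simp [M, Matrix.transvection, Matrix.one_apply, hij.symm]
  have row_inr_i : ∀ f : I g → ℚ, ∑ a, M (.inr i) a * f a = f (.inr i) - f (.inr j) := by
    intro f
    simp [M, Matrix.transvection, Matrix.one_apply, Matrix.single_apply, add_mul,
      Finset.sum_add_distrib, sub_eq_add_neg]
  have h := hF M hM (.inl j) (.inl i) (.inr i) (.inr i)
  simp only [row_inl_j, row_inl_i, row_inr_i] at h
  have e₁ : F (.inl j) (.inl i) (.inr i) (.inr j) = 0 := by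
    have := swap_indices hF i j (.inl i) (.inl j) (.inr j) (.inr i)
    simpa [h₂] using this
  have e₂ : F (.inl j) (.inl i) (.inr j) (.inr i) = 0 := by
    have := swap_indices hF i j (.inl i) (.inl j) (.inr i) (.inr j)
    simpa [h₁] using this
  have e₃ : F (.inl j) (.inl i) (.inr j) (.inr j) = 0 :=
    eq_zero_of_torusFactor hF i (by simp [torusFactor, hij.symm])
  have e₄ : F (.inl i) (.inl i) (.inr i) (.inr j) = 0 :=
    eq_zero_of_torusFactor hF i (by simp [torusFactor, hij.symm])
  have e₅ : F (.inl i) (.inl i) (.inr j) (.inr i) = 0 :=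
    eq_zero_of_torusFactor hF i (by simp [torusFactor, hij.symm])
  have e₆ : F (.inl i) (.inl i) (.inr j) (.inr j) = 0 :=
    eq_zero_of_torusFactor hF i (by simp [torusFactor, hij.symm]; norm_num)
  linarith

lemma apply_inl_inr_self (hF : F ∈ invariantArrays g) {i j : Fin g} (hij : i ≠ j)
    (h : F (.inl i) (.inr i) (.inl j) (.inr j) = 0) {e f : I g}
    (he : torusFactor i e = 1) (hf : torusFactor i f = 1) :
    F (.inl i) (.inr i) e f = 0 := by
  have h_diag : ∀ k, k ≠ i → F (.inl i) (.inr i) (.inl k) (.inr k) = 0 := by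
    intro k hk
    have := swap_indices hF j k (.inl i) (.inr i) (.inl j) (.inr j)
    simpa [Equiv.swap_apply_of_ne_of_ne hij hk.symm, h] using this
  have h_flip : ∀ k, k ≠ i → F (.inl i) (.inr i) (.inr k) (.inl k) = 0 := by
    intro k hk
    simpa [Equiv.swap_apply_def, hk.symm] using flip_eq_zero hF k (h_diag k hk)
  have hne : ∀ k, torusFactor i (.inl k) = 1 ∨ torusFactor i (.inr k) = 1 → k ≠ i := by
    rintro k hk rfl
    norm_num [torusFactor] at hk
  rcases e with k | k <;> rcases f with l | l
  · refine eq_zero_of_torusFactor hF k ?_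
    have := hne k (by simp [he])
    by_cases hl : l = k <;> norm_num [torusFactor, this.symm, hl]
  · have hk := hne k (by simp [he])
    by_cases hl : l = k
    · exact hl ▸ h_diag k hk
    · refine eq_zero_of_torusFactor hF k ?_
      norm_num [torusFactor, hk.symm, hl]
  · have hk := hne k (by simp [he])
    by_cases hl : l = k
    · exact hl ▸ h_flip k hk
    · refine eq_zero_of_torusFactor hF k ?_
      norm_num [torusFactor, hk.symm, hl]
  · refine eq_zero_of_torusFactor hF k ?_
    have := hne k (by simp [he])
    by_cases hl : l = k <;> norm_num [torusFactor, this.symm, hl]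

/-- An invariant array vanishes as soon as three of its entries do. -/
theorem eq_zero (hF : F ∈ invariantArrays g) {i j : Fin g} (hij : i ≠ j)
    (h₁₂ : F (.inl i) (.inr i) (.inl j) (.inr j) = 0)
    (h₁₃ : F (.inl i) (.inl j) (.inr i) (.inr j) = 0)
    (h₁₄ : F (.inl i) (.inl j) (.inr j) (.inr i) = 0) : F = 0 := by
  have hj₁ : torusFactor i (.inl j) = 1 := by simp [torusFactor, hij.symm]
  have hj₂ : torusFactor i (.inr j) = 1 := by simp [torusFactor, hij.symm]
  have m₁₂ {e f : I g} : torusFactor i e = 1 → torusFactor i f = 1 →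
      F (.inl i) (.inr i) e f = 0 := apply_inl_inr_self hF hij h₁₂
  have m₁₃ {e f : I g} : torusFactor i e = 1 → torusFactor i f = 1 →
      F (.inl i) e (.inr i) f = 0 := apply_inl_inr_self (swap_middle hF) hij h₁₃
  have m₁₄ {e f : I g} : torusFactor i e = 1 → torusFactor i f = 1 →
      F (.inl i) e f (.inr i) = 0 := apply_inl_inr_self (swap_middle (swap_last hF)) hij h₁₄
  have p₁₂ : F (.inl i) (.inl i) (.inr i) (.inr i) = 0 :=
    apply_inl_inl_inr_inr_self hF hij h₁₃ h₁₄
  have p₁₃ : F (.inl i) (.inr i) (.inl i) (.inr i) = 0 :=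
    apply_inl_inl_inr_inr_self (swap_middle hF) hij h₁₂ (m₁₄ hj₂ hj₁)
  have p₁₄ : F (.inl i) (.inr i) (.inr i) (.inl i) = 0 :=
    apply_inl_inl_inr_inr_self (swap_middle (swap_last hF)) hij (m₁₂ hj₂ hj₁) (m₁₃ hj₂ hj₁)
  have trichotomy : ∀ e : I g, e = .inl i ∨ e = .inr i ∨ torusFactor i e = 1 := by
    rintro (k | k) <;> by_cases hk : k = i <;> simp [torusFactor, hk]
  have t₁ : torusFactor i (.inl i) = 2 := by simp [torusFactor]
  have t₂ : torusFactor i (.inr i) = 1 / 2 := by simp [torusFactor]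
  have h_i : ∀ b c d, F (.inl i) b c d = 0 := by
    intro b c d
    rcases trichotomy b with rfl | rfl | hb <;> rcases trichotomy c with rfl | rfl | hc <;>
      rcases trichotomy d with rfl | rfl | hd <;>
      first
      | assumption
      | exact m₁₂ ‹_› ‹_›
      | exact m₁₃ ‹_› ‹_›
      | exact m₁₄ ‹_› ‹_›
      | exact eq_zero_of_torusFactor hF i (by norm_num [*])
  have h_inl : ∀ k b c d, F (.inl k) b c d = 0 := by
    intro k b c d
    have := swap_indices hF k i (.inl k) b c d
    simpa [h_i] using this.symm
  funext a b c d
  rcases a with k | k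
  · exact h_inl k b c d
  · have := flip_eq_zero hF k (h_inl k (Equiv.swap (.inl k) (.inr k) b)
      (Equiv.swap (.inl k) (.inr k) c) (Equiv.swap (.inl k) (.inr k) d))
    simpa using this

end invariantArrays

open scoped Matrix in
lemma pairH_eq_neg_dotProduct {g : ℕ} (u v : H g) :
    pairH g u v = -(u ⬝ᵥ Matrix.J (Fin g) ℚ *ᵥ v) := by
  simp [pairH, dotProduct, Matrix.J, Matrix.mulVec, Fintype.sum_sum_type, Matrix.one_apply,
    Finset.sum_sub_distrib]
  ring

open scoped Matrix in
lemma isSp_iff_toMatrix'_mem {g : ℕ} (A : H g ≃ₗ[ℚ] H g) :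
    IsSp g A ↔ LinearMap.toMatrix' A.toLinearMap ∈ Matrix.symplecticGroup (Fin g) ℚ := by
  set M := LinearMap.toMatrix' A.toLinearMap with hM
  have hA : ∀ u, A u = M *ᵥ u := fun u => by simp [hM, LinearMap.toMatrix'_mulVec]
  have h : ∀ u v, pairH g (A u) (A v) = -(u ⬝ᵥ (Mᵀ * Matrix.J (Fin g) ℚ * M) *ᵥ v) := by
    intro u v
    rw [pairH_eq_neg_dotProduct, hA, hA, ← Matrix.mulVec_mulVec, ← Matrix.mulVec_mulVec,
      Matrix.dotProduct_mulVec u, Matrix.vecMul_transpose]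
  rw [SymplecticGroup.mem_iff']
  constructor
  · intro hsp
    ext a b
    have := hsp (Pi.single a 1) (Pi.single b 1)
    rw [h, pairH_eq_neg_dotProduct] at this
    simpa using this
  · intro hJ u v
    rw [h, hJ, pairH_eq_neg_dotProduct]

lemma actT_four_apply {g : ℕ} (A : H g →ₗ[ℚ] H g) (t : T g 4) (p q r s : I g) :
    actT g 4 A t ![p, q, r, s] =
      ∑ a, LinearMap.toMatrix' A p a * ∑ b, LinearMap.toMatrix' A q b *
        ∑ c, LinearMap.toMatrix' A r c * ∑ d, LinearMap.toMatrix' A s d * t ![a, b, c, d] := by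
  let e : (I g × I g × I g × I g) ≃ (Fin 4 → I g) :=
    { toFun := fun x => ![x.1, x.2.1, x.2.2.1, x.2.2.2]
      invFun := fun φ => (φ 0, φ 1, φ 2, φ 3)
      left_inv := fun _ => rfl
      right_inv := fun φ => by ext i; fin_cases i <;> rfl }
  rw [actT, ← e.sum_comp]
  simp only [Fintype.sum_prod_type, Finset.mul_sum]
  refine Finset.sum_congr rfl fun a _ => Finset.sum_congr rfl fun b _ =>
    Finset.sum_congr rfl fun c _ => Finset.sum_congr rfl fun d _ => ?_
  have he : e (a, b, c, d) = ![a, b, c, d] := rfl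
  simp [he, Fin.prod_univ_four, LinearMap.toMatrix'_apply]
  ring

lemma invariant_iff_mem_invariantArrays {g : ℕ} (t : T g 4) :
    (∀ A : H g ≃ₗ[ℚ] H g, IsSp g A → actT g 4 A.toLinearMap t = t) ↔
      (fun a b c d => t ![a, b, c, d]) ∈ invariantArrays g := by
  constructor
  · intro h M hM p q r s
    have hu : IsUnit M.det := SymplecticGroup.symplectic_det hM
    have hA : LinearMap.toMatrix'
        (M.toLinearEquiv' (Matrix.invertibleOfIsUnitDet M hu)).toLinearMap = M := by
      rw [Matrix.toLinearEquiv'_apply, LinearMap.toMatrix'_toLin']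
    have := congrFun (h _ ((isSp_iff_toMatrix'_mem _).2 (hA.symm ▸ hM))) ![p, q, r, s]
    rwa [actT_four_apply, hA] at this
  · intro h A hA
    funext ψ
    have hψ : ψ = ![ψ 0, ψ 1, ψ 2, ψ 3] := by ext i; fin_cases i <;> rfl
    rw [hψ, actT_four_apply]
    exact h _ ((isSp_iff_toMatrix'_mem A).1 hA) _ _ _ _

lemma om0_apply {g : ℕ} (a b : I g) : om0 g ![a, b] = -Matrix.J (Fin g) ℚ a b := by
  rcases a with i | i <;> rcases b with j | j <;>
    simp [om0, xB, yB, Matrix.J, Matrix.one_apply, Pi.single_apply, eq_comm]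

/-- for `g ≥ 2`, the tensors `ω₁₂, ω₁₃, ω₁₄` form a basis of the subspace of
`Sp(2g,ℚ)`-invariant tensors in `H^{⊗4}`. -/
theorem stmt10 (g : ℕ) (hg : 2 ≤ g) :
    (∀ t : T g 4,
      (∀ A : H g ≃ₗ[ℚ] H g, IsSp g A → actT g 4 A.toLinearMap t = t) ↔
        t ∈ Submodule.span ℚ {om12 g, om13 g, om14 g}) ∧
    LinearIndependent ℚ ![om12 g, om13 g, om14 g] := by
  obtain ⟨i, j, hij⟩ : ∃ i j : Fin g, i ≠ j := ⟨⟨0, by omega⟩, ⟨1, by omega⟩, by simp⟩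
  have h₁₂ : (fun a b c d => om12 g ![a, b, c, d]) ∈ invariantArrays g := by
    simpa [om12, om0_apply] using invariantArrays.J_mul_J_mem (g := g)
  have h₁₃ : (fun a b c d => om13 g ![a, b, c, d]) ∈ invariantArrays g := by
    simpa [om12, om13] using invariantArrays.swap_middle h₁₂
  have h₁₄ : (fun a b c d => om14 g ![a, b, c, d]) ∈ invariantArrays g := by
    simpa [om13, om14] using invariantArrays.swap_last h₁₃
  have entries : ∀ k₁ k₂ k₃ : ℚ, ∀ u : T g 4, u = k₁ • om12 g + k₂ • om13 g + k₃ • om14 g →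
      u ![.inl i, .inr i, .inl j, .inr j] = k₁ ∧ u ![.inl i, .inl j, .inr i, .inr j] = k₂ ∧
        u ![.inl i, .inl j, .inr j, .inr i] = k₃ := by
    rintro k₁ k₂ k₃ u rfl
    simp [om12, om13, om14, om0_apply, Matrix.J, hij, hij.symm]
  refine ⟨fun t => ?_, ?_⟩
  · rw [invariant_iff_mem_invariantArrays, Submodule.mem_span_triple]
    constructor
    · intro ht
      refine ⟨t ![.inl i, .inr i, .inl j, .inr j], t ![.inl i, .inl j, .inr i, .inr j],
        t ![.inl i, .inl j, .inr j, .inr i], ?_⟩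
      set u : T g 4 := (_ : ℚ) • om12 g + (_ : ℚ) • om13 g + (_ : ℚ) • om14 g with hu
      obtain ⟨e₁, e₂, e₃⟩ := entries _ _ _ u hu
      have hmem : (fun a b c d => t ![a, b, c, d] - u ![a, b, c, d]) ∈ invariantArrays g :=
        sub_mem ht (add_mem (add_mem (Submodule.smul_mem _ _ h₁₂) (Submodule.smul_mem _ _ h₁₃))
          (Submodule.smul_mem _ _ h₁₄))
      have h0 := invariantArrays.eq_zero hmem hij (by simp [e₁]) (by simp [e₂]) (by simp [e₃])
      funext ψ
      have hψ : ψ = ![ψ 0, ψ 1, ψ 2, ψ 3] := by ext k; fin_cases k <;> rfl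
      have := congrFun (congrFun (congrFun (congrFun h0 (ψ 0)) (ψ 1)) (ψ 2)) (ψ 3)
      rw [hψ]
      exact (sub_eq_zero.1 this).symm
    · rintro ⟨k₁, k₂, k₃, rfl⟩
      exact add_mem (add_mem (Submodule.smul_mem _ _ h₁₂) (Submodule.smul_mem _ _ h₁₃))
        (Submodule.smul_mem _ _ h₁₄)
  · rw [Fintype.linearIndependent_iff]
    intro k hk
    obtain ⟨e₁, e₂, e₃⟩ := entries (k 0) (k 1) (k 2) 0
      (by simpa [Fin.sum_univ_three] using hk.symm)
    intro l
    fin_cases l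
    exacts [e₁.symm, e₂.symm, e₃.symm]
end

section
/- For g ≥ 2, the subspace of H^{⊗4} consisting of tensors fixed both by the cyclic permutation σ₄ and by the diagonal action of every element of Sp(2g,ℚ) is one-dimensional, spanned by ω₁₂ − ω₁₄. (Equivalently, the Sp-invariant part of 𝔞_g(2) is one-dimensional.) -/
section Combinatorics
variable {g : ℕ} {f : I g → I g → I g → I g → ℚ}

/-- The sign `ε` with `u · e_p = ε_p u_{p̄}`, where `p̄` is the index symplectically dual to `p`. -/
def dualSign (g : ℕ) : I g → ℚ := Sum.elim (fun _ => -1) (fun _ => 1)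

lemma dualSign_ne_zero (p : I g) : dualSign g p ≠ 0 := by
  rcases p with p | p <;> simp [dualSign]

lemma dualSign_swap (p : I g) : dualSign g p.swap = -dualSign g p := by
  rcases p with p | p <;> simp [dualSign]

lemma swap_ne_self (p : I g) : p.swap ≠ p := by
  rcases p with p | p <;> simp

/-- Invariance of the coordinates `f` of a 4-tensor under the Lie algebra `𝔰𝔭(2g)`, which is
spanned by the operators `u ↦ (u · e_p) e_r + (u · e_r) e_p`. -/
def IsLieInvariant (f : I g → I g → I g → I g → ℚ) : Prop :=
  ∀ p r a b c d : I g,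
    (if a = p then dualSign g r * f r.swap b c d else 0) +
    (if a = r then dualSign g p * f p.swap b c d else 0) +
    (if b = p then dualSign g r * f a r.swap c d else 0) +
    (if b = r then dualSign g p * f a p.swap c d else 0) +
    (if c = p then dualSign g r * f a b r.swap d else 0) +
    (if c = r then dualSign g p * f a b p.swap d else 0) +
    (if d = p then dualSign g r * f a b c r.swap else 0) +
    (if d = r then dualSign g p * f a b c p.swap else 0) = 0

lemma IsLieInvariant.weight (hf : IsLieInvariant f) {a b c d : I g} (h : f a b c d ≠ 0)
    (p : I g) :
    (if a = p then 1 else 0) + (if b = p then 1 else 0) + (if c = p then 1 else 0) +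
      (if d = p then 1 else 0) =
    (if a = p.swap then 1 else 0) + (if b = p.swap then 1 else 0) +
      (if c = p.swap then 1 else 0) + (if d = p.swap then (1 : ℚ) else 0) := by
  have key := hf p p.swap a b c d
  rw [dualSign_swap, Sum.swap_swap] at key
  have e1 : ∀ x : I g → ℚ, ∀ a p : I g, ∀ k : ℚ, (if a = p then k * x p else 0) =
      k * x a * (if a = p then 1 else 0) := by
    intro x a p k
    split_ifs with h
    · rw [h, mul_one]
    · rw [mul_zero]
  rw [e1 (fun x => f x b c d), e1 (fun x => f x b c d), e1 (fun x => f a x c d),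
    e1 (fun x => f a x c d), e1 (fun x => f a b x d), e1 (fun x => f a b x d),
    e1 (fun x => f a b c x), e1 (fun x => f a b c x)] at key
  apply mul_left_cancel₀ (mul_ne_zero (dualSign_ne_zero p) h)
  linear_combination -key

lemma IsLieInvariant.eq_zero_of_swap (hf : IsLieInvariant f)
    (h₁ : ∀ a b, f a a.swap b b.swap = 0) (h₂ : ∀ a b, f a b a.swap b.swap = 0)
    (h₃ : ∀ a b, f a b b.swap a.swap = 0) (a b c d : I g) : f a b c d = 0 := by
  by_contra h
  have w := hf.weight h
  have ha := w a
  have hb := w b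
  have hc := w c
  have s : ∀ p : I g, p.swap ≠ p := swap_ne_self
  have ss : ∀ p : I g, p.swap.swap = p := fun p => Sum.swap_swap p
  have hmem : b = a.swap ∨ c = a.swap ∨ d = a.swap := by
    by_contra! hne
    obtain ⟨n1, n2, n3⟩ := hne
    simp only [if_true, if_neg n1, if_neg n2, if_neg n3, if_neg (s a).symm] at ha
    split_ifs at ha <;> norm_num at ha
  rcases hmem with rfl | rfl | rfl
  · have : d = c.swap := by grind
    exact h (this ▸ h₁ a c)
  · have : d = b.swap := by grind
    exact h (this ▸ h₂ a b)
  · have : c = b.swap := by grind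
    exact h (this ▸ h₃ a b)

lemma IsLieInvariant.eq_zero_congr (hf : IsLieInvariant f) {a b c : I g}
    (hb : b ≠ a) (hb' : b ≠ a.swap) (hc : c ≠ a) (hc' : c ≠ a.swap)
    (h : f a a.swap b b.swap = 0) : f a a.swap c c.swap = 0 := by
  have s : ∀ p : I g, p.swap ≠ p := swap_ne_self
  have ss : ∀ p : I g, p.swap.swap = p := fun p => Sum.swap_swap p
  have nb := dualSign_ne_zero b
  have nc := dualSign_ne_zero c
  by_cases h1 : c = b
  · rwa [h1]
  by_cases h2 : c = b.swap
  · have := hf b b a a.swap b b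
    subst h2
    grind
  · have := hf b c.swap a a.swap b c.swap
    rw [dualSign_swap] at this
    grind

lemma IsLieInvariant.eq_zero (hf : IsLieInvariant f) (hcyc : ∀ a b c d, f d a b c = f a b c d)
    {i j : I g} (hij : i ≠ j) (hij' : i ≠ j.swap) (h₀ : f i i.swap j j.swap = 0)
    (a b c d : I g) : f a b c d = 0 := by
  have s : ∀ p : I g, p.swap ≠ p := swap_ne_self
  have ss : ∀ p : I g, p.swap.swap = p := fun p => Sum.swap_swap p
  have symm : ∀ {a b}, f a a.swap b b.swap = 0 → f b b.swap a a.swap = 0 := by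
    intro a b h
    rw [hcyc, hcyc, h]
  have hj : ∀ {b}, b ≠ i → b ≠ i.swap → f i i.swap b b.swap = 0 := fun hb hb' =>
    hf.eq_zero_congr (by grind) (by grind) hb hb' h₀
  have adj : ∀ {a b}, b ≠ a → b ≠ a.swap → f a a.swap b b.swap = 0 := by
    intro a b hb hb'
    by_cases h1 : a = i
    · subst h1; exact hj hb hb'
    by_cases h2 : a = i.swap
    · have : f a a.swap j j.swap = 0 :=
        symm (hf.eq_zero_congr (b := i) (by grind) (by grind) (by grind) (by grind) (symm h₀))
      exact hf.eq_zero_congr (by grind) (by grind) hb hb' this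
    · exact hf.eq_zero_congr (b := i) (by grind) (by grind) hb hb' (symm (hj h1 h2))
  have nest : ∀ {a b}, b ≠ a → b ≠ a.swap → f a b b.swap a.swap = 0 := by
    intro a b hb hb'
    have := @adj a.swap b (by grind) (by grind)
    rwa [ss, hcyc] at this
  have same : ∀ {a b}, b ≠ a → b ≠ a.swap →
      dualSign g b * f a b a.swap b.swap = dualSign g a * f a a a.swap a.swap ∧
      dualSign g b * f b a b.swap a.swap = dualSign g a * f a a a.swap a.swap := by
    intro a b hb hb'
    have h1 := hf a b.swap a a a.swap b.swap
    have h2 := hf a b.swap a a b.swap a.swap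
    have n1 := @nest a b hb hb'
    have n2 := @nest b a (by grind) (by grind)
    rw [dualSign_swap] at h1 h2
    grind
  have cross : ∀ {a b}, b ≠ a → b ≠ a.swap → f a b a.swap b.swap = 0 := by
    intro a b hb hb'
    have h1 := same hb hb'
    have h2 := @same a b.swap (by grind) (by grind)
    have h3 := hcyc a b a.swap b.swap
    have nb := dualSign_ne_zero b
    have h4 := hcyc b a b.swap a.swap
    rw [dualSign_swap, ss] at h2
    grind
  have diag : ∀ a, f a a a.swap a.swap = 0 := by
    intro a
    have na := dualSign_ne_zero a
    obtain ⟨b, hb, hb'⟩ : ∃ b, b ≠ a ∧ b ≠ a.swap := by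
      by_cases h : j = a ∨ j = a.swap
      · exact ⟨i, by grind, by grind⟩
      · exact ⟨j, by grind, by grind⟩
    have h1 := (same hb hb').1
    rw [cross hb hb'] at h1
    grind
  have diag' : ∀ a, f a a.swap a.swap a = 0 := fun a => by
    rw [← hcyc, diag]
  have alt : ∀ a, f a a.swap a a.swap = 0 := by
    intro a
    have h := hf a a a a a a.swap
    have na := dualSign_ne_zero a
    have h1 := diag' a.swap
    rw [ss] at h1
    have h2 := diag a
    grind
  refine hf.eq_zero_of_swap ?_ ?_ ?_ a b c d
  · intro a b
    by_cases h : b ≠ a ∧ b ≠ a.swap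
    · exact adj h.1 h.2
    · grind
  · intro a b
    by_cases h : b ≠ a ∧ b ≠ a.swap
    · exact cross h.1 h.2
    · grind
  · intro a b
    by_cases h : b ≠ a ∧ b ≠ a.swap
    · exact nest h.1 h.2
    · grind
end Combinatorics

section Contraction
variable {g : ℕ}

/-- The value of a 4-tensor on four covectors. -/
def contract (t : T g 4) (u₀ u₁ u₂ u₃ : H g) : ℚ :=
  ∑ i, ∑ j, ∑ k, ∑ l, t ![i, j, k, l] * (u₀ i * u₁ j * u₂ k * u₃ l)

/-- The row of the matrix of `A` with index `a`. -/
def matrixRow (A : H g →ₗ[ℚ] H g) (a : I g) : H g := fun i => A (Pi.single i 1) a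

lemma tensor_ext {s t : T g 4} (h : ∀ a b c d, s ![a, b, c, d] = t ![a, b, c, d]) : s = t := by
  funext ψ
  have hψ : ψ = ![ψ 0, ψ 1, ψ 2, ψ 3] := by
    funext q
    fin_cases q <;> rfl
  rw [hψ]
  exact h _ _ _ _

lemma sum_fin_four (F : (Fin 4 → I g) → ℚ) :
    ∑ φ, F φ = ∑ i, ∑ j, ∑ k, ∑ l, F ![i, j, k, l] := by
  let e : I g × I g × I g × I g ≃ (Fin 4 → I g) :=
    { toFun := fun p => ![p.1, p.2.1, p.2.2.1, p.2.2.2]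
      invFun := fun φ => (φ 0, φ 1, φ 2, φ 3)
      left_inv := fun _ => rfl
      right_inv := fun φ => by
        funext q
        fin_cases q <;> rfl }
  rw [← e.sum_comp]
  simp only [Fintype.sum_prod_type]
  rfl

lemma actT_apply (A : H g →ₗ[ℚ] H g) (t : T g 4) (a b c d : I g) :
    actT g 4 A t ![a, b, c, d] =
      contract t (matrixRow A a) (matrixRow A b) (matrixRow A c) (matrixRow A d) := by
  rw [actT, sum_fin_four]
  simp [contract, matrixRow, Fin.prod_univ_four]

lemma contract_single (t : T g 4) (a b c d : I g) :
    contract t (Pi.single a 1) (Pi.single b 1) (Pi.single c 1) (Pi.single d 1) =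
      t ![a, b, c, d] := by
  rw [contract, Finset.sum_eq_single a, Finset.sum_eq_single b, Finset.sum_eq_single c,
    Finset.sum_eq_single d] <;> simp +contextual [Pi.single_apply]

variable (t : T g 4) (r : ℚ) (u v u₀ u₁ u₂ u₃ : H g)

lemma contract_add₀ : contract t (u + v) u₁ u₂ u₃ =
    contract t u u₁ u₂ u₃ + contract t v u₁ u₂ u₃ := by
  simp only [contract, ← Finset.sum_add_distrib, Pi.add_apply]
  simp only [add_mul, mul_add]

lemma contract_add₁ : contract t u₀ (u + v) u₂ u₃ =
    contract t u₀ u u₂ u₃ + contract t u₀ v u₂ u₃ := by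
  simp only [contract, ← Finset.sum_add_distrib, Pi.add_apply]
  simp only [add_mul, mul_add]

lemma contract_add₂ : contract t u₀ u₁ (u + v) u₃ =
    contract t u₀ u₁ u u₃ + contract t u₀ u₁ v u₃ := by
  simp only [contract, ← Finset.sum_add_distrib, Pi.add_apply]
  simp only [add_mul, mul_add]

lemma contract_add₃ : contract t u₀ u₁ u₂ (u + v) =
    contract t u₀ u₁ u₂ u + contract t u₀ u₁ u₂ v := by
  simp only [contract, ← Finset.sum_add_distrib, Pi.add_apply]
  simp only [mul_add]

lemma contract_smul₀ : contract t (r • u) u₁ u₂ u₃ = r * contract t u u₁ u₂ u₃ := by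
  simp only [contract, Finset.mul_sum, Pi.smul_apply, smul_eq_mul, mul_assoc, mul_left_comm r]

lemma contract_smul₁ : contract t u₀ (r • u) u₂ u₃ = r * contract t u₀ u u₂ u₃ := by
  simp only [contract, Finset.mul_sum, Pi.smul_apply, smul_eq_mul, mul_assoc, mul_left_comm r]

lemma contract_smul₂ : contract t u₀ u₁ (r • u) u₃ = r * contract t u₀ u₁ u u₃ := by
  simp only [contract, Finset.mul_sum, Pi.smul_apply, smul_eq_mul, mul_assoc, mul_left_comm r]

lemma contract_smul₃ : contract t u₀ u₁ u₂ (r • u) = r * contract t u₀ u₁ u₂ u := by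
  simp only [contract, Finset.mul_sum, Pi.smul_apply, smul_eq_mul, mul_assoc, mul_left_comm r]

end Contraction

section Transvections
variable {g : ℕ}

lemma pairH_add_left (u v w : H g) : pairH g (u + v) w = pairH g u w + pairH g v w := by
  simp only [pairH, ← Finset.sum_add_distrib, Pi.add_apply]
  exact Finset.sum_congr rfl fun _ _ => by ring

lemma pairH_smul_left (c : ℚ) (u v : H g) : pairH g (c • u) v = c * pairH g u v := by
  simp only [pairH, Finset.mul_sum, Pi.smul_apply, smul_eq_mul]
  exact Finset.sum_congr rfl fun _ _ => by ring

lemma pairH_swap (u v : H g) : pairH g u v = -pairH g v u := by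
  simp only [pairH, ← Finset.sum_neg_distrib]
  exact Finset.sum_congr rfl fun _ _ => by ring

lemma pairH_self (u : H g) : pairH g u u = 0 := by
  linarith [pairH_swap u u]

lemma pairH_add_right (u v w : H g) : pairH g u (v + w) = pairH g u v + pairH g u w := by
  rw [pairH_swap, pairH_add_left, pairH_swap v, pairH_swap w]
  ring

lemma pairH_smul_right (c : ℚ) (u v : H g) : pairH g u (c • v) = c * pairH g u v := by
  rw [pairH_swap, pairH_smul_left, pairH_swap v]
  ring

/-- The functional `u ↦ u · v`. -/
def pairDual (v : H g) : Module.Dual ℚ (H g) where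
  toFun u := pairH g u v
  map_add' u w := pairH_add_left u w v
  map_smul' c u := pairH_smul_left c u v

/-- The symplectic transvection `u ↦ u + c (u · v) v`. -/
def symplecticTransvection (c : ℚ) (v : H g) : H g ≃ₗ[ℚ] H g :=
  LinearEquiv.transvection (f := c • pairDual v) (v := v)
    (by simp [pairDual, pairH_self])

lemma symplecticTransvection_apply (c : ℚ) (v u : H g) :
    symplecticTransvection c v u = u + (c * pairH g u v) • v := by
  rfl

lemma isSp_symplecticTransvection (c : ℚ) (v : H g) : IsSp g (symplecticTransvection c v) := by
  intro u w
  simp only [symplecticTransvection_apply, pairH_add_left, pairH_add_right, pairH_smul_left,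
    pairH_smul_right, pairH_self]
  rw [pairH_swap v w]
  ring

/-- The vector with coordinates `e_j · v`. -/
def pairVec (v : H g) : H g := fun j => pairH g (Pi.single j 1) v

lemma pairVec_add (v w : H g) : pairVec (v + w) = pairVec v + pairVec w :=
  funext fun _ => pairH_add_right _ _ _

lemma pairVec_single (p : I g) :
    pairVec (Pi.single p 1) = dualSign g p • (Pi.single p.swap 1 : H g) := by
  funext j
  rcases p with p | p <;> rcases j with j | j <;>
    simp [pairVec, pairH, dualSign, Pi.single_apply, eq_comm, neg_ite]

lemma matrixRow_symplecticTransvection (c : ℚ) (v : H g) (a : I g) :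
    matrixRow (symplecticTransvection c v).toLinearMap a =
      Pi.single a 1 + c • (v a • pairVec v) := by
  funext j
  simp only [matrixRow, LinearEquiv.coe_coe, symplecticTransvection_apply, pairVec, Pi.add_apply,
    Pi.smul_apply, smul_eq_mul, Pi.single_apply, eq_comm (a := a)]
  ring

lemma sum_contract_pairVec_eq_zero {t : T g 4}
    (ht : ∀ A : H g ≃ₗ[ℚ] H g, IsSp g A → actT g 4 A.toLinearMap t = t) (v : H g)
    (a b c d : I g) :
    v a * contract t (pairVec v) (Pi.single b 1) (Pi.single c 1) (Pi.single d 1) +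
    v b * contract t (Pi.single a 1) (pairVec v) (Pi.single c 1) (Pi.single d 1) +
    v c * contract t (Pi.single a 1) (Pi.single b 1) (pairVec v) (Pi.single d 1) +
    v d * contract t (Pi.single a 1) (Pi.single b 1) (Pi.single c 1) (pairVec v) = 0 := by
  have key (k : ℚ) := congrFun (ht _ (isSp_symplecticTransvection k v)) ![a, b, c, d]
  simp only [actT_apply, matrixRow_symplecticTransvection, contract_add₀, contract_add₁,
    contract_add₂, contract_add₃, contract_smul₀, contract_smul₁, contract_smul₂,
    contract_smul₃, contract_single] at key
  linear_combination (2 / 3) * key 1 - (2 / 3) * key (-1) - (1 / 12) * key 2 + (1 / 12) * key (-2)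

lemma isLieInvariant_of_isSp_invariant {t : T g 4}
    (ht : ∀ A : H g ≃ₗ[ℚ] H g, IsSp g A → actT g 4 A.toLinearMap t = t) :
    IsLieInvariant fun a b c d => t ![a, b, c, d] := by
  intro p r a b c d
  have h (v : H g) := sum_contract_pairVec_eq_zero ht v a b c d
  have hp := h (Pi.single p 1)
  have hr := h (Pi.single r 1)
  have hpr := h (Pi.single p 1 + Pi.single r 1)
  simp only [pairVec_add, pairVec_single, contract_add₀, contract_add₁,
    contract_add₂, contract_add₃, contract_smul₀, contract_smul₁, contract_smul₂,
    contract_smul₃, contract_single, Pi.add_apply, Pi.single_apply] at hp hr hpr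
  simp only [← boole_mul _ (_ * _)]
  linear_combination hpr - hp - hr

end Transvections

section Invariants
variable {g : ℕ}

open Matrix

lemma om0_eq_J (a b : I g) : om0 g ![a, b] = -J (Fin g) ℚ a b := by
  rcases a with a | a <;> rcases b with b | b <;>
    simp [om0, J, xB, yB, Pi.single_apply, Matrix.one_apply, eq_comm]

lemma om0_comm (a b : I g) : om0 g ![b, a] = -om0 g ![a, b] := by
  rw [om0_eq_J, om0_eq_J, ← transpose_apply (J (Fin g) ℚ) a b, J_transpose, neg_apply]

lemma pairH_eq_om0 (a b : I g) : pairH g (Pi.single a 1) (Pi.single b 1) = om0 g ![a, b] := by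
  rcases a with a | a <;> rcases b with b | b <;>
    simp [om0, pairH, xB, yB, Pi.single_apply, eq_comm]

lemma pairH_eq_sum (u v : H g) : pairH g u v = ∑ i, ∑ j, om0 g ![i, j] * (u i * v j) := by
  simp [om0_eq_J, J, pairH, Matrix.one_apply, Fintype.sum_sum_type,
    Finset.sum_add_distrib, sub_eq_add_neg]

lemma mul_J_mul_apply (M N : Matrix (I g) (I g) ℚ) (a b : I g) :
    (M * J (Fin g) ℚ * N) a b = -pairH g (M a) (Nᵀ b) := by
  rw [pairH_eq_sum, Finset.sum_comm]
  simp only [Matrix.mul_apply, Finset.sum_mul, ← Finset.sum_neg_distrib, om0_eq_J, transpose_apply]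
  exact Finset.sum_congr rfl fun _ _ => Finset.sum_congr rfl fun _ _ => by ring

lemma toMatrix_mem_symplecticGroup {A : H g ≃ₗ[ℚ] H g} (hA : IsSp g A) :
    LinearMap.toMatrix' A.toLinearMap ∈ symplecticGroup (Fin g) ℚ := by
  have hcol (a : I g) : (LinearMap.toMatrix' A.toLinearMap)ᵀ a = A (Pi.single a 1) := by
    funext b
    simp [LinearMap.toMatrix'_apply]
  rw [SymplecticGroup.mem_iff']
  ext a b
  rw [mul_J_mul_apply, hcol, hcol, hA, pairH_eq_om0, om0_eq_J, neg_neg]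

lemma pairH_matrixRow {A : H g ≃ₗ[ℚ] H g} (hA : IsSp g A) (a b : I g) :
    pairH g (matrixRow A.toLinearMap a) (matrixRow A.toLinearMap b) = om0 g ![a, b] := by
  have hrow (a : I g) : LinearMap.toMatrix' A.toLinearMap a = matrixRow A.toLinearMap a := by
    funext b
    simp [LinearMap.toMatrix'_apply, matrixRow]
  have h := congrFun (congrFun (SymplecticGroup.mem_iff.1 (toMatrix_mem_symplecticGroup hA)) a) b
  rw [mul_J_mul_apply, transpose_transpose, hrow, hrow] at h
  rw [om0_eq_J, ← h, neg_neg]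

lemma contract_sub (s t : T g 4) (u₀ u₁ u₂ u₃ : H g) :
    contract (s - t) u₀ u₁ u₂ u₃ = contract s u₀ u₁ u₂ u₃ - contract t u₀ u₁ u₂ u₃ := by
  simp only [contract, ← Finset.sum_sub_distrib, Pi.sub_apply, sub_mul]

lemma contract_om12 (u₀ u₁ u₂ u₃ : H g) :
    contract (om12 g) u₀ u₁ u₂ u₃ = pairH g u₀ u₁ * pairH g u₂ u₃ := by
  rw [pairH_eq_sum, pairH_eq_sum]
  simp only [Finset.sum_mul]
  simp only [Finset.mul_sum]
  exact Finset.sum_congr rfl fun _ _ => Finset.sum_congr rfl fun _ _ =>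
    Finset.sum_congr rfl fun _ _ => Finset.sum_congr rfl fun _ _ => by
      simp only [om12, Matrix.cons_val]
      ring

lemma contract_om14 (u₀ u₁ u₂ u₃ : H g) :
    contract (om14 g) u₀ u₁ u₂ u₃ = pairH g u₀ u₃ * pairH g u₁ u₂ := by
  have h : contract (om14 g) u₀ u₁ u₂ u₃ = contract (om12 g) u₀ u₃ u₁ u₂ := by
    refine Finset.sum_congr rfl fun i _ => ?_
    symm
    rw [Finset.sum_comm]
    refine Finset.sum_congr rfl fun j _ => ?_
    rw [Finset.sum_comm]
    refine Finset.sum_congr rfl fun k _ => Finset.sum_congr rfl fun l _ => ?_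
    simp only [om12, om14, Matrix.cons_val]
    ring
  rw [h, contract_om12]

lemma actT_om12_sub_om14 {A : H g ≃ₗ[ℚ] H g} (hA : IsSp g A) :
    actT g 4 A.toLinearMap (om12 g - om14 g) = om12 g - om14 g := by
  refine tensor_ext fun a b c d => ?_
  rw [actT_apply, contract_sub, contract_om12, contract_om14]
  simp only [pairH_matrixRow hA]
  rfl

lemma actT_sub (A : H g →ₗ[ℚ] H g) (s t : T g 4) :
    actT g 4 A (s - t) = actT g 4 A s - actT g 4 A t := by
  funext ψ
  simp [actT, sub_mul]

lemma actT_smul (A : H g →ₗ[ℚ] H g) (r : ℚ) (t : T g 4) :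
    actT g 4 A (r • t) = r • actT g 4 A t := by
  funext ψ
  simp [actT, Finset.mul_sum, mul_assoc]

lemma cyc_apply (t : T g 4) (a b c d : I g) : cyc g 4 t ![a, b, c, d] = t ![d, a, b, c] := by
  unfold cyc
  congr 1
  funext q
  fin_cases q <;> rfl

lemma cyc_om12_sub_om14 : cyc g 4 (om12 g - om14 g) = om12 g - om14 g := by
  refine tensor_ext fun a b c d => ?_
  rw [cyc_apply]
  simp [om12, om14]
  rw [om0_comm a d, om0_comm d c]
  ring

end Invariants

/-- for `g ≥ 2`, the subspace of `H^{⊗4}` of tensors fixed by the cyclic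
permutation `σ₄` and by the diagonal `Sp(2g,ℚ)`-action is one-dimensional, spanned by
`ω₁₂ - ω₁₄`. -/
theorem stmt11 (g : ℕ) (hg : 2 ≤ g) :
    om12 g - om14 g ≠ 0 ∧
    (∀ t : T g 4,
      (cyc g 4 t = t ∧ ∀ A : H g ≃ₗ[ℚ] H g, IsSp g A → actT g 4 A.toLinearMap t = t) ↔
        t ∈ Submodule.span ℚ {om12 g - om14 g}) := by
  let p : Fin g := ⟨0, by omega⟩
  let q : Fin g := ⟨1, by omega⟩
  have hpq : p ≠ q := by simp [p, q]
  have hω : (om12 g - om14 g) ![.inl p, .inr p, .inl q, .inr q] = 1 := by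
    simp [om12, om14, om0_eq_J, Matrix.J, hpq]
  refine ⟨fun h => by rw [h] at hω; exact zero_ne_one hω, fun t => ?_⟩
  rw [Submodule.mem_span_singleton]
  constructor
  · rintro ⟨hcyc, hSp⟩
    set r := t ![.inl p, .inr p, .inl q, .inr q]
    have hs := isLieInvariant_of_isSp_invariant (t := t - r • (om12 g - om14 g)) fun A hA => by
      rw [actT_sub, actT_smul, hSp A hA, actT_om12_sub_om14 hA]
    have hs_cyc : cyc g 4 (t - r • (om12 g - om14 g)) = t - r • (om12 g - om14 g) := by
      conv_rhs => rw [← hcyc, ← cyc_om12_sub_om14]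
      rfl
    refine ⟨r, (sub_eq_zero.1 (tensor_ext fun a b c d => ?_)).symm⟩
    refine hs.eq_zero (i := .inl p) (j := .inl q) (fun a b c d => ?_) (by simpa using hpq)
      (by simp) ?_ a b c d
    · exact (cyc_apply _ a b c d).symm.trans (congrFun hs_cyc _)
    · change r - r * (om12 g - om14 g) ![.inl p, .inr p, .inl q, .inr q] = 0
      rw [hω, mul_one, sub_self]
  · rintro ⟨r, rfl⟩
    refine ⟨?_, fun A hA => by rw [actT_smul, actT_om12_sub_om14 hA]⟩
    conv_rhs => rw [← cyc_om12_sub_om14]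
    rfl
end

section
/- Let k satisfy 2 ≤ k ≤ g. Then C_k(λ_k) ≠ 0 if and only if k ≡ 1 (mod 4). -/
/-- the `k`-gon contraction `C_k : H^{⊗2k} → ℚ`,
`u₁⊗v₁⊗⋯⊗u_k⊗v_k ↦ (v₁·u₂)(v₂·u₃)⋯(v_{k-1}·u_k)(v_k·u₁)` (indices cyclic). -/
def Ck (g k : ℕ) (hk : 2 ≤ k) (t : T g (2*k)) : ℚ :=
  ∑ φ : Fin (2*k) → I g, t φ *
    ∏ i : Fin k,
      pairH g (Pi.single (φ ⟨2*i.1+1, by have := i.2; omega⟩) 1)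
        (Pi.single (φ ⟨2*((i + ⟨1, by omega⟩ : Fin k)).1, by have := ((i + ⟨1, by omega⟩ : Fin k)).2; omega⟩) 1)

/-- `λ^{(i)} = x_i ⊗ y_{i+1} - y_{i+1} ⊗ x_i` (indices cyclic modulo `k`, embedded into
`Fin g` via `k ≤ g`). -/
def lamSmall (g k : ℕ) (hk : 2 ≤ k) (hkg : k ≤ g) (i : Fin k) : T g 2 := fun φ =>
  xB g (Fin.castLE hkg i) (φ 0) * yB g (Fin.castLE hkg (i + ⟨1, by omega⟩)) (φ 1)
    - yB g (Fin.castLE hkg (i + ⟨1, by omega⟩)) (φ 0) * xB g (Fin.castLE hkg i) (φ 1)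

/-- `λ_k = Σ_{τ ∈ S_k} sgn(τ) λ^{(τ(1))} ⊗ ⋯ ⊗ λ^{(τ(k))} ∈ H^{⊗2k}`. -/
def lamBig (g k : ℕ) (hk : 2 ≤ k) (hkg : k ≤ g) : T g (2*k) := fun φ =>
  ∑ τ : Equiv.Perm (Fin k), ((Equiv.Perm.sign τ : ℤ) : ℚ) *
    ∏ i : Fin k,
      lamSmall g k hk hkg (τ i)
        ![φ ⟨2*i.1, by have := i.2; omega⟩, φ ⟨2*i.1+1, by have := i.2; omega⟩]

/-- The bijection between sequences of pairs of length `k` and sequences of length `2 * k`. -/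
def pairSeqEquiv (α : Type*) (k : ℕ) : (Fin k → α × α) ≃ (Fin (2 * k) → α) where
  toFun ψ j := if j.1 % 2 = 0 then (ψ ⟨j.1 / 2, by omega⟩).1 else (ψ ⟨j.1 / 2, by omega⟩).2
  invFun φ i := (φ ⟨2 * i.1, by omega⟩, φ ⟨2 * i.1 + 1, by omega⟩)
  left_inv ψ := by
    funext i
    have h : (2 * i.1 + 1) / 2 = i.1 := by omega
    ext1 <;> simp [Nat.add_mod, h]
  right_inv φ := by
    funext j
    by_cases h : j.1 % 2 = 0
    · simp only [h, if_true]
      congr 1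
      ext
      simp only
      omega
    · simp only [h, if_false]
      congr 1
      ext
      simp only
      omega

lemma pairSeqEquiv_apply_even {α : Type*} {k : ℕ} (ψ : Fin k → α × α) (i : Fin k)
    (h : 2 * i.1 < 2 * k) : pairSeqEquiv α k ψ ⟨2 * i.1, h⟩ = (ψ i).1 := by
  simp [pairSeqEquiv]

lemma pairSeqEquiv_apply_odd {α : Type*} {k : ℕ} (ψ : Fin k → α × α) (i : Fin k)
    (h : 2 * i.1 + 1 < 2 * k) : pairSeqEquiv α k ψ ⟨2 * i.1 + 1, h⟩ = (ψ i).2 := by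
  have h' : (2 * i.1 + 1) / 2 = i.1 := by omega
  simp [pairSeqEquiv, Nat.add_mod, h']

lemma sum_prod_sum_ite_mul {ι β α : Type*} [Fintype ι] [DecidableEq ι] [Fintype β] [Fintype α]
    [DecidableEq α] (s : β → ℚ) (w : ι → β → α) (G : (ι → α) → ℚ) :
    ∑ ψ : ι → α, (∏ i, ∑ e, s e * (if ψ i = w i e then 1 else 0)) * G ψ
      = ∑ ε : ι → β, (∏ i, s (ε i)) * G (fun i => w i (ε i)) := by
  simp_rw [Fintype.prod_sum, Finset.sum_mul]
  rw [Finset.sum_comm]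
  refine Finset.sum_congr rfl fun ε _ => ?_
  rw [Finset.sum_eq_single (fun i => w i (ε i))]
  · simp
  · intro ψ _ hψ
    obtain ⟨i, hi⟩ := Function.ne_iff.mp hψ
    rw [Finset.prod_eq_zero (Finset.mem_univ i) (by simp [hi]), zero_mul]
  · simp

lemma Fin.eq_apply_zero_of_apply_add_one {α : Type*} {n : ℕ} (f : Fin (n + 1) → α)
    (h : ∀ i, f (i + 1) = f i) (i : Fin (n + 1)) : f i = f 0 := by
  induction i using Fin.induction with
  | zero => rfl
  | succ i ih => rw [← Fin.coeSucc_eq_succ, h, ih]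

lemma pairH_inl_inl (g : ℕ) (a b : Fin g) :
    pairH g (Pi.single (Sum.inl a) 1) (Pi.single (Sum.inl b) 1) = 0 := by
  simp [pairH, Pi.single_apply]

lemma pairH_inr_inr (g : ℕ) (a b : Fin g) :
    pairH g (Pi.single (Sum.inr a) 1) (Pi.single (Sum.inr b) 1) = 0 := by
  simp [pairH, Pi.single_apply]

lemma pairH_inl_inr (g : ℕ) (a b : Fin g) :
    pairH g (Pi.single (Sum.inl a) 1) (Pi.single (Sum.inr b) 1) = if a = b then 1 else 0 := by
  simp [pairH, Pi.single_apply, eq_comm]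

lemma pairH_inr_inl (g : ℕ) (a b : Fin g) :
    pairH g (Pi.single (Sum.inr a) 1) (Pi.single (Sum.inl b) 1) = -if a = b then 1 else 0 := by
  simp [pairH, Pi.single_apply, eq_comm]

/-- The two basis tensors occurring in `λ^{(j)}`. -/
def lamTerm {g k : ℕ} (hk : 2 ≤ k) (hkg : k ≤ g) (j : Fin k) (e : Bool) : I g × I g :=
  bif e then (Sum.inl (Fin.castLE hkg j), Sum.inr (Fin.castLE hkg (j + ⟨1, by omega⟩)))
  else (Sum.inr (Fin.castLE hkg (j + ⟨1, by omega⟩)), Sum.inl (Fin.castLE hkg j))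

lemma lamSmall_eq_sum {g k : ℕ} (hk : 2 ≤ k) (hkg : k ≤ g) (j : Fin k) (p : I g × I g) :
    lamSmall g k hk hkg j ![p.1, p.2]
      = ∑ e : Bool, (bif e then 1 else -1) * (if p = lamTerm hk hkg j e then 1 else 0) := by
  obtain ⟨a, b⟩ := p
  simp only [lamSmall, xB, yB, lamTerm, Fintype.sum_bool, Pi.single_apply, Prod.mk.injEq,
    cond_true, cond_false, ite_and, Matrix.cons_val_zero, Matrix.cons_val_one]
  split_ifs <;> simp

lemma Ck_lamBig_eq_sum_perm {g k : ℕ} (hk : 2 ≤ k) (hkg : k ≤ g) :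
    Ck g k hk (lamBig g k hk hkg) = ∑ τ : Equiv.Perm (Fin k), ((Equiv.Perm.sign τ : ℤ) : ℚ) *
      ∑ ε : Fin k → Bool, (∏ i, (bif ε i then (1 : ℚ) else -1)) * ∏ i,
        pairH g (Pi.single (lamTerm hk hkg (τ i) (ε i)).2 1)
          (Pi.single (lamTerm hk hkg (τ (i + ⟨1, by omega⟩)) (ε (i + ⟨1, by omega⟩))).1 1) := by
  unfold Ck lamBig
  rw [← (pairSeqEquiv (I g) k).sum_comp]
  simp_rw [Finset.sum_mul]
  rw [Finset.sum_comm]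
  refine Finset.sum_congr rfl fun τ _ => ?_
  simp_rw [mul_assoc]
  rw [← Finset.mul_sum]
  congr 1
  have key := sum_prod_sum_ite_mul (fun e : Bool => bif e then (1 : ℚ) else -1)
    (fun i => lamTerm hk hkg (τ i)) (fun ψ : Fin k → I g × I g => ∏ i : Fin k,
      pairH g (Pi.single (ψ i).2 1) (Pi.single (ψ (i + ⟨1, by omega⟩)).1 1))
  simp only [← lamSmall_eq_sum] at key
  simp only [pairSeqEquiv_apply_even, pairSeqEquiv_apply_odd]
  exact key

lemma sum_bool_eq_ite_add_ite {g n : ℕ} (hk : 2 ≤ n + 2) (hkg : n + 2 ≤ g)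
    (τ : Equiv.Perm (Fin (n + 2))) :
    ∑ ε : Fin (n + 2) → Bool, (∏ i, (bif ε i then (1 : ℚ) else -1)) * ∏ i,
        pairH g (Pi.single (lamTerm hk hkg (τ i) (ε i)).2 1)
          (Pi.single (lamTerm hk hkg (τ (i + 1)) (ε (i + 1))).1 1)
      = (-1) ^ (n + 2) * ((if ∀ i, τ (i + 1) = τ i + 1 then 1 else 0)
        + (if ∀ i, τ i = τ (i + 1) + 1 then 1 else 0)) := by
  have hone : (⟨1, by omega⟩ : Fin (n + 2)) = 1 := rfl
  rw [← Finset.sum_subset (Finset.subset_univ {fun _ => true, fun _ => false}),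
    Finset.sum_pair (fun h => by simpa using congrFun h 0)]
  · simp [lamTerm, pairH_inl_inr, pairH_inr_inl, hone, Finset.prod_neg, Finset.prod_ite_zero,
      mul_add, eq_comm]
  · intro ε _ hε
    have : ∃ i, ε (i + 1) ≠ ε i := by
      by_contra! h
      have hc := Fin.eq_apply_zero_of_apply_add_one ε h
      apply hε
      cases h0 : ε 0
      · simp [funext_iff, hc, h0]
      · simp [funext_iff, hc, h0]
    obtain ⟨i, hi⟩ := this
    refine mul_eq_zero_of_right _ (Finset.prod_eq_zero (Finset.mem_univ i) ?_)
    cases h0 : ε i <;> cases h1 : ε (i + 1)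
    · simp [h0, h1] at hi
    · exact pairH_inl_inl ..
    · exact pairH_inr_inr ..
    · simp [h0, h1] at hi

lemma sign_addRight_add_one {n : ℕ} (c : Fin (n + 1)) :
    Equiv.Perm.sign (Equiv.addRight (c + 1))
      = (-1) ^ n * Equiv.Perm.sign (Equiv.addRight c) := by
  have : Equiv.addRight (c + 1) = finRotate (n + 1) * Equiv.addRight c := by
    ext i
    simp [add_assoc]
  rw [this, map_mul, sign_finRotate]
  simp

lemma sign_revPerm (n : ℕ) :
    Equiv.Perm.sign (Fin.revPerm : Equiv.Perm (Fin n)) = (-1) ^ (n * (n - 1) / 2) := by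
  rw [Equiv.Perm.sign_eq_prod_prod_Iio, ← Finset.sum_range_id, ← Fin.sum_univ_eq_sum_range,
    ← Finset.prod_pow_eq_pow_sum]
  refine Finset.prod_congr rfl fun j _ => ?_
  rw [Finset.prod_congr rfl (g := fun _ => -1)]
  · simp
  · intro i hi
    rw [if_neg]
    simpa using (Finset.mem_Iio.mp hi).le

lemma sum_sign_rotations {n : ℕ} :
    ∑ τ : Equiv.Perm (Fin (n + 1)), ((Equiv.Perm.sign τ : ℤ) : ℚ) *
        (if ∀ i, τ (i + 1) = τ i + 1 then 1 else 0)
      = ∑ c : Fin (n + 1), ((Equiv.Perm.sign (Equiv.addRight c) : ℤ) : ℚ) := by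
  symm
  refine Fintype.sum_of_injective Equiv.addRight
    (fun a b h => by simpa using Equiv.congr_fun h 0) _ _ ?_ ?_
  · intro τ hτ
    rw [if_neg, mul_zero]
    intro h
    apply hτ
    have := Fin.eq_apply_zero_of_apply_add_one (fun i => τ i - i) (fun i => by rw [h]; abel)
    refine ⟨τ 0, Equiv.ext fun i => ?_⟩
    have := this i
    simp only [sub_zero] at this
    simp [← this]
  · intro c
    rw [if_pos, mul_one]
    intro i
    simp only [Equiv.coe_addRight]
    abel

lemma sum_sign_reflections {n : ℕ} :
    ∑ τ : Equiv.Perm (Fin (n + 1)), ((Equiv.Perm.sign τ : ℤ) : ℚ) *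
        (if ∀ i, τ i = τ (i + 1) + 1 then 1 else 0)
      = (-1) ^ ((n + 1) * n / 2) *
        ∑ c : Fin (n + 1), ((Equiv.Perm.sign (Equiv.addRight c) : ℤ) : ℚ) := by
  have hrev : ((Equiv.Perm.sign (Fin.revPerm : Equiv.Perm (Fin (n + 1))) : ℤ) : ℚ)
      = (-1) ^ ((n + 1) * n / 2) := by
    rw [sign_revPerm]
    simp
  rw [← sum_sign_rotations, Finset.mul_sum, ← Equiv.sum_comp (Equiv.mulLeft Fin.revPerm)]
  refine Finset.sum_congr rfl fun τ _ => ?_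
  have (i : Fin (n + 1)) : Fin.rev (τ i) = Fin.rev (τ (i + 1)) + 1 ↔ τ (i + 1) = τ i + 1 := by
    rw [← Fin.last_sub, ← Fin.last_sub, sub_add_eq_add_sub, sub_eq_sub_iff_add_eq_add,
      add_assoc, add_right_inj, add_comm 1, eq_comm, eq_comm]
  simp [this, ← hrev]

lemma sum_sign_addRight (n : ℕ) :
    ∑ c : Fin (n + 1), ((Equiv.Perm.sign (Equiv.addRight c) : ℤ) : ℚ)
      = if Even n then (n + 1 : ℚ) else 0 := by
  have h (c : Fin (n + 1)) := sign_addRight_add_one c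
  split_ifs with hn
  · have h1 := Fin.eq_apply_zero_of_apply_add_one
      (fun c : Fin (n + 1) => Equiv.Perm.sign (Equiv.addRight c)) (fun c => by
        simp only [h, hn.neg_one_pow, one_mul])
    simp [h1]
  · have h1 := Fintype.sum_equiv (Equiv.addRight (1 : Fin (n + 1)))
      (fun c => ((Equiv.Perm.sign (Equiv.addRight (c + 1)) : ℤ) : ℚ))
      (fun c => ((Equiv.Perm.sign (Equiv.addRight c) : ℤ) : ℚ)) (fun _ => rfl)
    simp only [h, (Nat.not_even_iff_odd.mp hn).neg_one_pow, neg_mul, one_mul, Units.val_neg,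
      Int.cast_neg, Finset.sum_neg_distrib] at h1
    linarith

lemma Ck_lamBig {g n : ℕ} (hk : 2 ≤ n + 2) (hkg : n + 2 ≤ g) :
    Ck g (n + 2) hk (lamBig g (n + 2) hk hkg)
      = (-1) ^ (n + 2) * (1 + (-1) ^ ((n + 2) * (n + 1) / 2))
        * (if Even (n + 1) then (n + 2 : ℚ) else 0) := by
  rw [Ck_lamBig_eq_sum_perm]
  refine (Finset.sum_congr rfl fun τ _ => congrArg _ (sum_bool_eq_ite_add_ite hk hkg τ)).trans ?_
  have h := sum_sign_addRight (n + 1)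
  rw [Nat.cast_add_one, add_assoc (n : ℚ), one_add_one_eq_two] at h
  simp_rw [mul_left_comm _ ((-1 : ℚ) ^ (n + 2)), mul_add (_ : ℚ)]
  have hr : ∑ τ : Equiv.Perm (Fin (n + 2)), ((Equiv.Perm.sign τ : ℤ) : ℚ) *
        (if ∀ i, τ i = τ (i + 1) + 1 then 1 else 0)
      = (-1) ^ ((n + 2) * (n + 1) / 2) * _ := sum_sign_reflections
  rw [Finset.sum_add_distrib, ← Finset.mul_sum, ← Finset.mul_sum, sum_sign_rotations,
    hr, h]
  ring

/-- for `2 ≤ k ≤ g`, `C_k(λ_k) ≠ 0` if and only if `k ≡ 1 (mod 4)`. -/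
theorem stmt12 (g k : ℕ) (hg : 2 ≤ g) (hk : 2 ≤ k) (hkg : k ≤ g) :
    Ck g k hk (lamBig g k hk hkg) ≠ 0 ↔ k % 4 = 1 := by
  obtain ⟨n, rfl⟩ := Nat.exists_eq_add_of_le' hk
  rw [Ck_lamBig]
  by_cases hn : Even (n + 1)
  · obtain ⟨m, hm⟩ := hn
    have he : (n + 2) * (n + 1) / 2 = (n + 2) * m := by
      rw [hm, ← two_mul, mul_left_comm, Nat.mul_div_cancel_left _ two_pos]
    have hodd : Odd (n + 2) := ⟨m, by omega⟩
    have hpos : (n + 2 : ℚ) ≠ 0 := by positivity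
    rw [he, pow_mul, hodd.neg_one_pow, if_pos ⟨m, hm⟩]
    rcases Nat.even_or_odd m with hm' | hm'
    · rw [hm'.neg_one_pow]
      obtain ⟨r, hr⟩ := hm'
      exact iff_of_true (mul_ne_zero (by norm_num) hpos) (by omega)
    · rw [hm'.neg_one_pow]
      obtain ⟨r, hr⟩ := hm'
      exact iff_of_false (by simp) (by omega)
  · rw [if_neg hn, mul_zero]
    rw [Nat.even_iff] at hn
    exact iff_of_false (by simp) (by omega)
end

section
/- Let V be a finite-dimensional ℚ-vector space. For all linear maps D₁, D₂ : V → V^{⊗2}, one has C₁₃([D₁,D₂]) = 0 in V^{⊗2}; consequently C₁₃ induces a surjective linear map from the quotient Hom(V, V^{⊗3}) / span{[D₁,D₂] : D₁,D₂ ∈ Hom(V,V^{⊗2})} onto V^{⊗2}. -/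
set_option maxSynthPendingDepth 2

open scoped TensorProduct

/-- `V^{⊗2}` -/
abbrev TT2 (V : Type*) [AddCommGroup V] [Module ℚ V] := V ⊗[ℚ] V
/-- `V^{⊗3}` (with the left-associated grouping) -/
abbrev TT3 (V : Type*) [AddCommGroup V] [Module ℚ V] := (V ⊗[ℚ] V) ⊗[ℚ] V

/-- The unique extension of a linear map `D : V → V⊗V` to a derivation of the tensor
algebra, restricted to a map `V^{⊗2} → V^{⊗3}`; on decomposables it is
`u₁ ⊗ u₂ ↦ D(u₁) ⊗ u₂ + u₁ ⊗ D(u₂)`. -/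
noncomputable def ext1 {V : Type*} [AddCommGroup V] [Module ℚ V]
    (D : V →ₗ[ℚ] TT2 V) : TT2 V →ₗ[ℚ] TT3 V :=
  TensorProduct.map D LinearMap.id +
    (TensorProduct.assoc ℚ V V V).symm.toLinearMap ∘ₗ TensorProduct.map LinearMap.id D

/-- the bracket `[D₁, D₂]`, i.e. the restriction to `V` of `D̃₁ ∘ D̃₂ - D̃₂ ∘ D̃₁`. -/
noncomputable def brkt {V : Type*} [AddCommGroup V] [Module ℚ V]
    (D₁ D₂ : V →ₗ[ℚ] TT2 V) : V →ₗ[ℚ] TT3 V :=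
  ext1 D₁ ∘ₗ D₂ - ext1 D₂ ∘ₗ D₁

section Contraction

variable {V : Type*} [AddCommGroup V] [Module ℚ V]

/-- The map `V^{⊗3} → V^{⊗2}` which pairs the middle tensor factor with `f`,
as a linear function of `f`. -/
noncomputable def contractMiddle : Module.Dual ℚ V →ₗ[ℚ] TT3 V →ₗ[ℚ] TT2 V :=
  LinearMap.rTensorHom V ∘ₗ
    LinearMap.compRight ℚ (TensorProduct.rid ℚ V).toLinearMap ∘ₗ LinearMap.lTensorHom V

@[simp]
theorem contractMiddle_tmul (f : Module.Dual ℚ V) (u₁ u₂ u₃ : V) :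
    contractMiddle f ((u₁ ⊗ₜ u₂) ⊗ₜ u₃) = f u₂ • (u₁ ⊗ₜ[ℚ] u₃) := by
  simp [contractMiddle, TensorProduct.smul_tmul']

theorem ext1_add (D D' : V →ₗ[ℚ] TT2 V) : ext1 (D + D') = ext1 D + ext1 D' := by
  simp only [ext1, TensorProduct.map_add_left, TensorProduct.map_add_right, LinearMap.comp_add]
  abel

theorem ext1_zero : ext1 (0 : V →ₗ[ℚ] TT2 V) = 0 := by
  simp [ext1]

theorem brkt_add_left (D D' E : V →ₗ[ℚ] TT2 V) : brkt (D + D') E = brkt D E + brkt D' E := by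
  simp only [brkt, ext1_add, LinearMap.add_comp, LinearMap.comp_add]
  abel

theorem brkt_add_right (D E E' : V →ₗ[ℚ] TT2 V) : brkt D (E + E') = brkt D E + brkt D E' := by
  simp only [brkt, ext1_add, LinearMap.add_comp, LinearMap.comp_add]
  abel

theorem brkt_zero_left (E : V →ₗ[ℚ] TT2 V) : brkt 0 E = 0 := by
  simp [brkt, ext1_zero]

theorem brkt_zero_right (E : V →ₗ[ℚ] TT2 V) : brkt E 0 = 0 := by
  simp [brkt, ext1_zero]

theorem brkt_dualTensorHom (f g : Module.Dual ℚ V) (a b c d : V) :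
    brkt (dualTensorHom ℚ V (TT2 V) (f ⊗ₜ (a ⊗ₜ b))) (dualTensorHom ℚ V (TT2 V) (g ⊗ₜ (c ⊗ₜ d))) =
      dualTensorHom ℚ V (TT3 V)
        (g ⊗ₜ (f c • ((a ⊗ₜ b) ⊗ₜ d) + f d • ((c ⊗ₜ a) ⊗ₜ b)) -
          f ⊗ₜ (g a • ((c ⊗ₜ d) ⊗ₜ b) + g b • ((a ⊗ₜ c) ⊗ₜ d))) := by
  ext v
  simp [brkt, ext1, TensorProduct.smul_tmul', smul_comm (f d), smul_comm (g b)]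

variable [FiniteDimensional ℚ V]

/-- The contraction `Hom(V, V^{⊗3}) → V^{⊗2}` of the argument against the middle factor. -/
noncomputable def contraction : (V →ₗ[ℚ] TT3 V) →ₗ[ℚ] TT2 V :=
  TensorProduct.lift contractMiddle ∘ₗ (dualTensorHomEquiv ℚ V (TT3 V)).symm.toLinearMap

theorem contraction_dualTensorHom (x : Module.Dual ℚ V ⊗[ℚ] TT3 V) :
    contraction (dualTensorHom ℚ V (TT3 V) x) = TensorProduct.lift contractMiddle x := by
  have h : dualTensorHom ℚ V (TT3 V) x = dualTensorHomEquiv ℚ V (TT3 V) x := by simp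
  rw [h, contraction, LinearMap.comp_apply, LinearEquiv.coe_coe, LinearEquiv.symm_apply_apply]

theorem dualTensorHom_tmul_induction {p : (V →ₗ[ℚ] TT2 V) → Prop} (D : V →ₗ[ℚ] TT2 V)
    (zero : p 0) (add : ∀ D D', p D → p D' → p (D + D'))
    (tmul : ∀ (f : Module.Dual ℚ V) (a b : V), p (dualTensorHom ℚ V (TT2 V) (f ⊗ₜ (a ⊗ₜ b)))) :
    p D := by
  obtain ⟨x, rfl⟩ := (dualTensorHomEquiv ℚ V (TT2 V)).surjective D
  induction x with
  | zero => simpa using zero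
  | add x y hx hy => simpa using add _ _ hx hy
  | tmul f y =>
    induction y using TensorProduct.induction_on with
    | zero => simpa using zero
    | add x y hx hy => simpa [TensorProduct.tmul_add] using add _ _ hx hy
    | tmul a b => simpa using tmul f a b

theorem contraction_brkt (D₁ D₂ : V →ₗ[ℚ] TT2 V) : contraction (brkt D₁ D₂) = 0 := by
  induction D₁ using dualTensorHom_tmul_induction with
  | zero => rw [brkt_zero_left, map_zero]
  | add D D' h h' => rw [brkt_add_left, map_add, h, h', add_zero]
  | tmul f a b =>
    induction D₂ using dualTensorHom_tmul_induction with
    | zero => rw [brkt_zero_right, map_zero]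
    | add D D' h h' => rw [brkt_add_right, map_add, h, h', add_zero]
    | tmul g c d =>
      rw [brkt_dualTensorHom, contraction_dualTensorHom]
      simp only [map_sub, map_add, map_smul, TensorProduct.lift.tmul, contractMiddle_tmul]
      module

theorem contraction_surjective : Function.Surjective (contraction (V := V)) := by
  rw [← LinearMap.range_eq_top, eq_top_iff, ← TensorProduct.span_tmul_eq_top, Submodule.span_le]
  rintro _ ⟨u, w, rfl⟩
  rcases eq_or_ne u 0 with rfl | hu
  · simp
  · obtain ⟨f, hf⟩ : ∃ f : Module.Dual ℚ V, f u ≠ 0 := by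
      by_contra! h
      exact hu ((Module.forall_dual_apply_eq_zero_iff ℚ u).mp h)
    refine ⟨dualTensorHom ℚ V (TT3 V) (f ⊗ₜ ((((f u)⁻¹ • u) ⊗ₜ u) ⊗ₜ w)), ?_⟩
    rw [contraction_dualTensorHom, TensorProduct.lift.tmul, contractMiddle_tmul,
      ← TensorProduct.smul_tmul', smul_smul, mul_inv_cancel₀ hf, one_smul]

end Contraction

/-- for a finite-dimensional `ℚ`-vector space `V` and the contraction
`C₁₃ : Hom(V, V^{⊗3}) → V^{⊗2}` (corresponding to `f⊗u₁⊗u₂⊗u₃ ↦ f(u₂)·u₁⊗u₃` under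
`Hom(V,V^{⊗3}) ≅ V*⊗V^{⊗3}`), one has `C₁₃([D₁,D₂]) = 0` for all `D₁, D₂ : V → V^{⊗2}`;
consequently `C₁₃` induces a surjective linear map from
`Hom(V,V^{⊗3})/span{[D₁,D₂]}` onto `V^{⊗2}`. -/
theorem stmt13 (V : Type*) [AddCommGroup V] [Module ℚ V] [FiniteDimensional ℚ V] :
    ∃ C : (V →ₗ[ℚ] TT3 V) →ₗ[ℚ] TT2 V,
      (∀ (f : Module.Dual ℚ V) (u₁ u₂ u₃ : V),
        C (dualTensorHom ℚ V (TT3 V) (f ⊗ₜ ((u₁ ⊗ₜ u₂) ⊗ₜ u₃))) = f u₂ • (u₁ ⊗ₜ u₃)) ∧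
      (∀ D₁ D₂ : V →ₗ[ℚ] TT2 V, C (brkt D₁ D₂) = 0) ∧
      ∃ Cbar : ((V →ₗ[ℚ] TT3 V) ⧸
            Submodule.span ℚ {E | ∃ D₁ D₂ : V →ₗ[ℚ] TT2 V, E = brkt D₁ D₂}) →ₗ[ℚ] TT2 V,
        (∀ D : V →ₗ[ℚ] TT3 V, Cbar (Submodule.Quotient.mk D) = C D) ∧
        Function.Surjective Cbar := by
  refine ⟨contraction, fun f u₁ u₂ u₃ ↦ ?_, contraction_brkt, Submodule.liftQ _ contraction ?_,
    fun D ↦ Submodule.liftQ_apply _ _ _, fun x ↦ ?_⟩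
  · rw [contraction_dualTensorHom, TensorProduct.lift.tmul, contractMiddle_tmul]
  · rw [Submodule.span_le]
    rintro _ ⟨D₁, D₂, rfl⟩
    exact contraction_brkt D₁ D₂
  · obtain ⟨D, rfl⟩ := contraction_surjective x
    exact ⟨Submodule.Quotient.mk D, Submodule.liftQ_apply _ _ _⟩
end

section
/- For g ≥ 4, every element of 𝔩_g(2) is a finite sum of brackets [D₁,D₂] with D₁, D₂ ∈ 𝔩_g(1); that is, the bracket map Λ²𝔩_g(1) → 𝔩_g(2) is surjective. -/
set_option maxSynthPendingDepth 2

open scoped TensorProduct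

/-- the free Lie algebra over `ℚ` generated by the vector space `H` -/
abbrev L (g : ℕ) := FreeLieAlgebra ℚ (I g)

/-- the canonical (linear) embedding `ι : H → L` -/
noncomputable def iotaL (g : ℕ) : H g →ₗ[ℚ] L g where
  toFun u := ∑ j : I g, u j • FreeLieAlgebra.of ℚ j
  map_add' u v := by
    simp only [Pi.add_apply, add_smul]
    exact Finset.sum_add_distrib
  map_smul' a u := by
    simp only [Pi.smul_apply, smul_eq_mul, RingHom.id_apply, mul_smul]
    rw [Finset.smul_sum]

/-- the degree `m` homogeneous component `L(m)` of the free Lie algebra: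
`L(1) = ι(H)` and `L(m+1) = span{[ι(u), ξ] : u ∈ H, ξ ∈ L(m)}`. -/
noncomputable def LS (g : ℕ) : ℕ → Submodule ℚ (L g)
  | 0 => ⊥
  | 1 => LinearMap.range (iotaL g)
  | (m+2) => Submodule.span ℚ {z : L g | ∃ u : H g, ∃ ξ ∈ LS g (m+1), z = ⁅iotaL g u, ξ⁆}

/-- the symplectic class `ω₀ = Σᵢ [ι(xᵢ), ι(yᵢ)] ∈ L(2)` -/
noncomputable def om0L (g : ℕ) : L g := ∑ i : Fin g, ⁅iotaL g (xB g i), iotaL g (yB g i)⁆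

/-- the degree `k` part `𝔩_g(k)` of the Lie algebra of symplectic derivations of `L`:
linear maps `D : H → L(k+1)` whose unique extension to a derivation `D̃` of `L`
kills `ω₀`. -/
def lset (g k : ℕ) : Set (H g →ₗ[ℚ] ↥(LS g (k+1))) :=
  {D | ∃ d : LieDerivation ℚ (L g) (L g),
        (∀ u : H g, d (iotaL g u) = (D u : L g)) ∧ d (om0L g) = 0}

/-! ### Derivations of the free Lie algebra -/

/-- The Lie algebra `M ⊗ ℚ[ε]/(ε²)`, realised on pairs `(a, b) = a + ε b`. -/
def DualLie (M : Type*) := M × M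

namespace DualLie

variable {M : Type*} [LieRing M]

instance : AddCommGroup (DualLie M) := inferInstanceAs (AddCommGroup (M × M))

instance : Bracket (DualLie M) (DualLie M) where
  bracket x y := (⁅x.1, y.1⁆, ⁅x.1, y.2⁆ + ⁅x.2, y.1⁆)

lemma fst_lie (x y : DualLie M) : (⁅x, y⁆).1 = ⁅x.1, y.1⁆ := rfl
lemma snd_lie (x y : DualLie M) : (⁅x, y⁆).2 = ⁅x.1, y.2⁆ + ⁅x.2, y.1⁆ := rfl
lemma fst_add (x y : DualLie M) : (x + y).1 = x.1 + y.1 := rfl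
lemma snd_add (x y : DualLie M) : (x + y).2 = x.2 + y.2 := rfl

instance : LieRing (DualLie M) where
  add_lie x y z := by
    refine Prod.ext ?_ ?_
    · simp only [fst_lie, fst_add, add_lie]
    · simp only [snd_lie, snd_add, fst_add, add_lie]; abel
  lie_add x y z := by
    refine Prod.ext ?_ ?_
    · simp only [fst_lie, fst_add, lie_add]
    · simp only [snd_lie, snd_add, fst_add, lie_add]; abel
  lie_self x := by
    refine Prod.ext (lie_self x.1) ?_
    change ⁅x.1, x.2⁆ + ⁅x.2, x.1⁆ = 0
    rw [← lie_skew x.1 x.2]; abel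
  leibniz_lie x y z := by
    refine Prod.ext (leibniz_lie x.1 y.1 z.1) ?_
    simp only [snd_lie, snd_add, fst_lie, lie_add, add_lie]
    rw [leibniz_lie x.1 y.1 z.2, leibniz_lie x.1 y.2 z.1, leibniz_lie x.2 y.1 z.1]
    abel

variable [LieAlgebra ℚ M]

instance : Module ℚ (DualLie M) := inferInstanceAs (Module ℚ (M × M))

instance : LieAlgebra ℚ (DualLie M) where
  lie_smul t x y := by
    refine Prod.ext (lie_smul t x.1 y.1) ?_
    change ⁅x.1, t • y.2⁆ + ⁅x.2, t • y.1⁆ = t • (⁅x.1, y.2⁆ + ⁅x.2, y.1⁆)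
    rw [lie_smul, lie_smul, smul_add]

end DualLie

section derivation

variable {X : Type*}

/-- The homomorphism `a ↦ a + ε d(a)` where `d` is the derivation extending `f`. -/
noncomputable def dualLift (f : X → FreeLieAlgebra ℚ X) :
    FreeLieAlgebra ℚ X →ₗ⁅ℚ⁆ DualLie (FreeLieAlgebra ℚ X) :=
  FreeLieAlgebra.lift ℚ fun x =>
    ((FreeLieAlgebra.of ℚ x, f x) : FreeLieAlgebra ℚ X × FreeLieAlgebra ℚ X)

lemma dualLift_of (f : X → FreeLieAlgebra ℚ X) (x : X) :
    dualLift f (FreeLieAlgebra.of ℚ x) =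
    ((FreeLieAlgebra.of ℚ x, f x) : FreeLieAlgebra ℚ X × FreeLieAlgebra ℚ X) :=
  FreeLieAlgebra.lift_of_apply _ _

lemma dualLift_fst (f : X → FreeLieAlgebra ℚ X) (a : FreeLieAlgebra ℚ X) :
    (dualLift f a).1 = a := by
  let p : FreeLieAlgebra ℚ X →ₗ⁅ℚ⁆ FreeLieAlgebra ℚ X :=
    { toFun := fun a => (dualLift f a).1
      map_add' := fun a b => by rw [map_add]; rfl
      map_smul' := fun t a => by rw [map_smul]; rfl
      map_lie' := fun {a b} => by rw [LieHom.map_lie]; rfl }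
  have : p = LieHom.id := FreeLieAlgebra.hom_ext fun x => by
    change (dualLift f (FreeLieAlgebra.of ℚ x)).1 = FreeLieAlgebra.of ℚ x
    rw [dualLift_of]
  exact congrArg (fun q : FreeLieAlgebra ℚ X →ₗ⁅ℚ⁆ FreeLieAlgebra ℚ X => q a) this

/-- The derivation of the free Lie algebra with prescribed values on the generators. -/
noncomputable def freeDer (f : X → FreeLieAlgebra ℚ X) :
    LieDerivation ℚ (FreeLieAlgebra ℚ X) (FreeLieAlgebra ℚ X) where
  toFun a := (dualLift f a).2
  map_add' a b := by rw [map_add]; rfl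
  map_smul' t a := by rw [map_smul]; rfl
  leibniz' a b := by
    change (dualLift f ⁅a, b⁆).2 = ⁅a, (dualLift f b).2⁆ - ⁅b, (dualLift f a).2⁆
    rw [LieHom.map_lie, DualLie.snd_lie, dualLift_fst, dualLift_fst, ← lie_skew b, sub_neg_eq_add]

@[simp] lemma freeDer_of (f : X → FreeLieAlgebra ℚ X) (x : X) :
    freeDer f (FreeLieAlgebra.of ℚ x) = f x := by
  change (dualLift f (FreeLieAlgebra.of ℚ x)).2 = f x
  rw [dualLift_of]

end derivation

/-! ### The symplectic form on basis vectors, tripods and trees -/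

section trees

variable {g : ℕ}

/-- generators of the free Lie algebra -/
noncomputable abbrev gen (i : I g) : L g := FreeLieAlgebra.of ℚ i

lemma iotaL_single (i : I g) : iotaL g (Pi.single i 1) = gen i := by
  change ∑ j : I g, (Pi.single i (1 : ℚ) : H g) j • gen j = gen i
  rw [Finset.sum_eq_single i]
  · simp
  · intro j _ h
    simp [h]
  · simp

lemma iotaL_apply (u : H g) : iotaL g u = ∑ j : I g, u j • gen j := rfl

/-- the sign `ω(a, a*)` -/
def sgn : I g → ℚ
  | Sum.inl _ => 1
  | Sum.inr _ => -1

/-- the symplectic form on basis vectors -/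
def symp (a b : I g) : ℚ := if b = a.swap then sgn a else 0

lemma sgn_swap (a : I g) : sgn a.swap = -sgn a := by cases a <;> simp [sgn]

lemma sgn_mul_self (a : I g) : sgn a * sgn a = 1 := by cases a <;> simp [sgn]

lemma symp_swap_right (a : I g) : symp a a.swap = sgn a := by simp [symp]

lemma symp_skew (a b : I g) : symp b a = -symp a b := by
  rcases a with i | i <;> rcases b with j | j <;> simp [symp, sgn, eq_comm] <;> split_ifs <;> simp

lemma om0L_eq : om0L g = ∑ i : Fin g, ⁅gen (Sum.inl i), gen (Sum.inr i)⁆ := by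
  simp only [om0L, xB, yB, iotaL_single]

lemma der_om0L (d : LieDerivation ℚ (L g) (L g)) :
    d (om0L g) = ∑ a : I g, ⁅gen a, sgn a • d (gen a.swap)⁆ := by
  rw [om0L_eq, map_sum, Fintype.sum_sum_type, ← Finset.sum_add_distrib]
  refine Finset.sum_congr rfl fun i _ => ?_
  simp only [LieDerivation.apply_lie_eq_sub, sgn, Sum.swap_inl, Sum.swap_inr, one_smul, neg_smul,
    lie_neg]
  abel

/-- the tripod with legs `a, b, c`, as an assignment on generators -/
noncomputable def tripod (a b c : I g) (j : I g) : L g :=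
  symp a j • ⁅gen b, gen c⁆ + symp b j • ⁅gen c, gen a⁆ + symp c j • ⁅gen a, gen b⁆

/-- the tree with legs `a, b` at one end and `c, d` at the other -/
noncomputable def tree (a b c d : I g) (j : I g) : L g :=
  symp a j • ⁅gen b, ⁅gen c, gen d⁆⁆ - symp b j • ⁅gen a, ⁅gen c, gen d⁆⁆ +
    symp c j • ⁅gen d, ⁅gen a, gen b⁆⁆ - symp d j • ⁅gen c, ⁅gen a, gen b⁆⁆

lemma sum_lie_symp (a : I g) (ξ : L g) :
    ∑ b : I g, ⁅gen b, sgn b • symp a b.swap • ξ⁆ = ⁅gen a, ξ⁆ := by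
  rw [Finset.sum_eq_single a]
  · simp [symp_swap_right, smul_smul, sgn_mul_self]
  · intro b _ h
    have : b.swap ≠ a.swap := fun h' => h (Sum.swap_leftInverse.injective h')
    simp [symp, this]
  · simp

lemma freeDer_tripod_om0L (a b c : I g) : freeDer (tripod a b c) (om0L g) = 0 := by
  rw [der_om0L]
  simp only [freeDer_of, tripod, smul_add, lie_add, Finset.sum_add_distrib, sum_lie_symp]
  exact lie_jacobi _ _ _

lemma tree_skew_left (a b c d : I g) : tree b a c d = -tree a b c d := by
  funext j
  simp only [tree, Pi.neg_apply, ← lie_skew (gen b) (gen a), lie_neg]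
  module

lemma tree_symm (a b c d : I g) : tree c d a b = tree a b c d := by
  funext j
  simp only [tree]
  module

lemma tree_ihx (a b c d : I g) : tree a b c d + tree b c a d + tree c a b d = 0 := by
  funext j
  have hd : ∀ p q : I g, ⁅gen d, ⁅gen p, gen q⁆⁆ =
      ⁅gen q, ⁅gen p, gen d⁆⁆ - ⁅gen p, ⁅gen q, gen d⁆⁆ := fun p q => by
    rw [← lie_skew, lie_lie, neg_sub]
  have hc : ⁅gen c, ⁅gen a, gen b⁆⁆ = -⁅gen a, ⁅gen b, gen c⁆⁆ - ⁅gen b, ⁅gen c, gen a⁆⁆ := by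
    rw [eq_sub_iff_add_eq, eq_neg_iff_add_eq_zero, ← lie_jacobi (gen a) (gen b) (gen c)]
    abel
  simp only [tree, Pi.add_apply, Pi.zero_apply, hd, hc]
  module

lemma bracket_tripod (a₁ a₂ a₃ b₁ b₂ b₃ : I g) (j : I g) :
    freeDer (tripod a₁ a₂ a₃) (tripod b₁ b₂ b₃ j) - freeDer (tripod b₁ b₂ b₃) (tripod a₁ a₂ a₃ j)
    = (symp a₁ b₁ • tree a₂ a₃ b₂ b₃ + symp a₁ b₂ • tree a₂ a₃ b₃ b₁ + symp a₁ b₃ • tree a₂ a₃ b₁ b₂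
     + symp a₂ b₁ • tree a₃ a₁ b₂ b₃ + symp a₂ b₂ • tree a₃ a₁ b₃ b₁ + symp a₂ b₃ • tree a₃ a₁ b₁ b₂
     + symp a₃ b₁ • tree a₁ a₂ b₂ b₃ + symp a₃ b₂ • tree a₁ a₂ b₃ b₁
     + symp a₃ b₃ • tree a₁ a₂ b₁ b₂) j := by
  have hs : ∀ a b c : I g, freeDer (tripod a₁ a₂ a₃) (symp c j • ⁅gen a, gen b⁆) =
    symp c j • (⁅gen a, tripod a₁ a₂ a₃ b⁆ - ⁅gen b, tripod a₁ a₂ a₃ a⁆) := by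
    intro a b c
    rw [map_smul, LieDerivation.apply_lie_eq_sub, freeDer_of, freeDer_of]
  have hs' : ∀ a b c : I g, freeDer (tripod b₁ b₂ b₃) (symp c j • ⁅gen a, gen b⁆) =
    symp c j • (⁅gen a, tripod b₁ b₂ b₃ b⁆ - ⁅gen b, tripod b₁ b₂ b₃ a⁆) := by
    intro a b c
    rw [map_smul, LieDerivation.apply_lie_eq_sub, freeDer_of, freeDer_of]
  rw [tripod, tripod, map_add, map_add, map_add, map_add]
  simp only [hs, hs']
  simp only [tripod, tree, lie_add, lie_smul, Pi.add_apply, Pi.smul_apply,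
    symp_skew a₁, symp_skew a₂,
    symp_skew a₃]
  module

/-! ### Vanishing of trees modulo brackets of tripods -/

/-- the index in `Fin g` of a generator `x_i` or `y_i` -/
def idx : I g → Fin g := Sum.elim id id

lemma idx_swap (a : I g) : idx a.swap = idx a := by cases a <;> rfl

lemma symp_of_idx_ne {a b : I g} (h : idx a ≠ idx b) : symp a b = 0 := by
  rw [symp, if_neg]
  rintro rfl
  exact h (idx_swap a).symm

lemma symp_self (a : I g) : symp a a = 0 := by cases a <;> simp [symp]

lemma symp_swap_left (a : I g) : symp a.swap a = -sgn a := by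
  rw [symp_skew, symp_swap_right]

lemma eq_or_eq_swap_of_idx_eq {a b : I g} (h : idx a = idx b) : b = a ∨ b = a.swap := by
  rcases a with i | i <;> rcases b with j | j <;> simp_all [idx]

lemma exists_idx_notMem (hg : 4 ≤ g) (a b c : Fin g) :
    ∃ e : I g, idx e ≠ a ∧ idx e ≠ b ∧ idx e ≠ c := by
  have h : ({a, b, c} : Finset (Fin g)).card < (Finset.univ : Finset (Fin g)).card := by
    rw [Finset.card_univ, Fintype.card_fin]
    exact lt_of_le_of_lt Finset.card_le_three hg
  obtain ⟨k, -, hk⟩ := Finset.exists_mem_notMem_of_card_lt_card h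
  simp only [Finset.mem_insert, Finset.mem_singleton, not_or] at hk
  exact ⟨Sum.inl k, hk⟩

/-- The formal properties of trees modulo the span of brackets of tripods. -/
structure IsTreeSystem {N : Type*} [AddCommGroup N] [Module ℚ N]
    (t : I g → I g → I g → I g → N) : Prop where
  skew : ∀ a b c d, t b a c d = -t a b c d
  symm : ∀ a b c d, t c d a b = t a b c d
  ihx : ∀ a b c d, t a b c d + t b c a d + t c a b d = 0
  contract : ∀ a₁ a₂ a₃ b₁ b₂ b₃,
    symp a₁ b₁ • t a₂ a₃ b₂ b₃ + symp a₁ b₂ • t a₂ a₃ b₃ b₁ + symp a₁ b₃ • t a₂ a₃ b₁ b₂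
     + symp a₂ b₁ • t a₃ a₁ b₂ b₃ + symp a₂ b₂ • t a₃ a₁ b₃ b₁ + symp a₂ b₃ • t a₃ a₁ b₁ b₂
     + symp a₃ b₁ • t a₁ a₂ b₂ b₃ + symp a₃ b₂ • t a₁ a₂ b₃ b₁ + symp a₃ b₃ • t a₁ a₂ b₁ b₂ = 0

namespace IsTreeSystem

variable {N : Type*} [AddCommGroup N] [Module ℚ N] {t : I g → I g → I g → I g → N}

lemma skew_right (ht : IsTreeSystem t) (a b c d : I g) : t a b d c = -t a b c d := by
  rw [← ht.symm, ht.skew, ht.symm]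

/-- contraction along an index `e` disjoint from all legs -/
lemma contract_free (ht : IsTreeSystem t) {a b c d e : I g} (ha : idx e ≠ idx a)
    (hb : idx e ≠ idx b) (hc : idx e ≠ idx c) (hd : idx e ≠ idx d) :
    sgn e • t a b c d + symp a c • t b e d e.swap - symp a d • t b e c e.swap
      - symp b c • t a e d e.swap + symp b d • t a e c e.swap = 0 := by
  have h := ht.contract a b e c d e.swap
  simp only [symp_swap_right, symp_of_idx_ne hc, symp_of_idx_ne hd,
    symp_of_idx_ne (a := a) (b := e.swap) (by rw [idx_swap]; exact ha.symm),
    symp_of_idx_ne (a := b) (b := e.swap) (by rw [idx_swap]; exact hb.symm)] at h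
  rw [ht.skew_right b e c e.swap, ht.skew a e d e.swap, ht.skew a e e.swap c,
    ht.skew_right a e c e.swap] at h
  rw [← h]
  module

/-- the trees `t b e d e*` for varying `e` disjoint from `b` and `d` cancel up to signs -/
lemma smul_add_smul_eq_zero (ht : IsTreeSystem t) {b d e f : I g} (hbe : idx e ≠ idx b)
    (hde : idx e ≠ idx d) (hbf : idx f ≠ idx b) (hdf : idx f ≠ idx d) (hef : idx f ≠ idx e)
    (hbd : symp b d = 0) :
    sgn e • t b e d e.swap + sgn f • t b f d f.swap = 0 := by
  have h := ht.contract_free (a := b) (b := e) (c := d) (d := e.swap) hbf hef hdf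
    (by rwa [idx_swap])
  rw [hbd, symp_of_idx_ne (a := b) (b := e.swap) (by rw [idx_swap]; exact hbe.symm),
    symp_of_idx_ne hde, symp_swap_right] at h
  have h' := congrArg (fun z => (sgn e * sgn f) • z) h
  simp only [zero_smul, sub_zero, add_zero, smul_add, smul_zero, smul_smul] at h'
  rw [mul_assoc, sgn_mul_self, mul_right_comm, sgn_mul_self, mul_one, one_mul] at h'
  exact h'

lemma of_smul_sgn (e : I g) {z : N} (h : sgn e • z = 0) : z = 0 := by
  rw [← one_smul ℚ z, ← sgn_mul_self e, ← smul_smul, h, smul_zero]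

lemma loop_self (ht : IsTreeSystem t) (hg : 4 ≤ g) {b e : I g} (hbe : idx e ≠ idx b) :
    t b e b e.swap = 0 := by
  obtain ⟨f, hfb, hfe, -⟩ := exists_idx_notMem hg (idx b) (idx e) (idx e)
  obtain ⟨k, hkb, hke, hkf⟩ := exists_idx_notMem hg (idx b) (idx e) (idx f)
  have h1 := ht.smul_add_smul_eq_zero hbe hbe hfb hfb hfe (symp_self b)
  have h2 := ht.smul_add_smul_eq_zero hbe hbe hkb hkb hke (symp_self b)
  have h3 := ht.smul_add_smul_eq_zero hfb hfb hkb hkb hkf (symp_self b)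
  refine of_smul_sgn e ?_
  linear_combination (norm := module) (1 / 2 : ℚ) • h1 + (1 / 2 : ℚ) • h2 - (1 / 2 : ℚ) • h3

lemma loop_of_idx_ne (ht : IsTreeSystem t) (hg : 4 ≤ g) {b d e : I g} (hbd : idx b ≠ idx d)
    (hbe : idx e ≠ idx b) (hde : idx e ≠ idx d) : t b e d e.swap = 0 := by
  have key : ∀ e : I g, idx e ≠ idx b → idx e ≠ idx d →
      sgn e • t b e d e.swap = sgn b • t b.swap b b d := by
    intro e hbe hde
    have h := ht.contract b e b.swap b d e.swap
    simp only [symp_self, symp_of_idx_ne hbd, symp_of_idx_ne hbe, symp_of_idx_ne hde,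
      symp_swap_left, symp_swap_right,
      symp_of_idx_ne (a := b) (b := e.swap) (by rw [idx_swap]; exact hbe.symm),
      symp_of_idx_ne (a := b.swap) (b := d) (by rwa [idx_swap]),
      symp_of_idx_ne (a := b.swap) (b := e.swap) (by rw [idx_swap, idx_swap]; exact hbe.symm)] at h
    have h' := congrArg (fun z => (sgn e * sgn b) • z) h
    simp only [zero_smul, add_zero, zero_add, smul_add, smul_zero, smul_smul] at h'
    rw [mul_right_comm, sgn_mul_self, mul_neg, mul_assoc, sgn_mul_self, mul_one, one_mul,
      neg_smul, ← sub_eq_add_neg, sub_eq_zero] at h'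
    exact h'.symm
  obtain ⟨f, hfb, hfd, hfe⟩ := exists_idx_notMem hg (idx b) (idx d) (idx e)
  have h1 := ht.smul_add_smul_eq_zero hbe hde hfb hfd hfe (symp_of_idx_ne hbd)
  have h2 := key e hbe hde
  have h3 := key f hfb hfd
  refine of_smul_sgn e ?_
  linear_combination (norm := module) (1 / 2 : ℚ) • h1 + (1 / 2 : ℚ) • h2 - (1 / 2 : ℚ) • h3

lemma swap_middle (ht : IsTreeSystem t) (hg : 4 ≤ g) {e f : I g} (hef : idx e ≠ idx f) :
    t e f.swap e.swap f = t e f e.swap f.swap := by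
  obtain ⟨k, hke, hkf, -⟩ := exists_idx_notMem hg (idx e) (idx f) (idx f)
  have h := ht.contract_free (a := e.swap) (b := e) (c := f) (d := f.swap) (e := k)
    (by rwa [idx_swap]) hke hkf (by rwa [idx_swap])
  rw [symp_of_idx_ne hef, symp_of_idx_ne (a := e) (b := f.swap) (by rwa [idx_swap]),
    symp_of_idx_ne (a := e.swap) (b := f) (by rwa [idx_swap]),
    symp_of_idx_ne (a := e.swap) (b := f.swap) (by rwa [idx_swap, idx_swap])] at h
  simp only [zero_smul, sub_zero, add_zero] at h
  have h0 := of_smul_sgn k h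
  have h1 := ht.ihx e f e.swap f.swap
  rw [h0, add_zero, ht.symm e f.swap f e.swap, ht.skew_right e f.swap e.swap f] at h1
  exact (add_neg_eq_zero.mp h1).symm

lemma loop_dual (ht : IsTreeSystem t) (hg : 4 ≤ g) {b e : I g} (hbe : idx e ≠ idx b) :
    t b e b.swap e.swap = 0 := by
  have key : ∀ f : I g, idx f ≠ idx b → idx f ≠ idx e →
      sgn b • t e f e.swap f.swap + sgn e • t b f b.swap f.swap +
        sgn f • t b e b.swap e.swap = 0 := by
    intro f hfb hfe
    have h := ht.contract b e f b.swap e.swap f.swap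
    rw [symp_of_idx_ne (a := b) (b := e.swap) (by rw [idx_swap]; exact hbe.symm),
      symp_of_idx_ne (a := b) (b := f.swap) (by rw [idx_swap]; exact hfb.symm),
      symp_of_idx_ne (a := e) (b := b.swap) (by rwa [idx_swap]),
      symp_of_idx_ne (a := e) (b := f.swap) (by rw [idx_swap]; exact hfe.symm),
      symp_of_idx_ne (a := f) (b := b.swap) (by rwa [idx_swap]),
      symp_of_idx_ne (a := f) (b := e.swap) (by rwa [idx_swap])] at h
    simp only [symp_swap_right, zero_smul, add_zero] at h
    rw [ht.skew b f, ht.skew_right b f b.swap f.swap, neg_neg] at h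
    exact h
  obtain ⟨f, hfb, hfe, -⟩ := exists_idx_notMem hg (idx b) (idx e) (idx e)
  have h1 := key f hfb hfe
  have h2 := key f.swap (by rwa [idx_swap]) (by rwa [idx_swap])
  rw [Sum.swap_swap, sgn_swap, ht.swap_middle hg hfe.symm, ht.swap_middle hg hfb.symm] at h2
  refine of_smul_sgn f ?_
  linear_combination (norm := module) (1 / 2 : ℚ) • h1 - (1 / 2 : ℚ) • h2

lemma loop_eq_zero (ht : IsTreeSystem t) (hg : 4 ≤ g) {b d e : I g}
    (hbe : idx e ≠ idx b) (hde : idx e ≠ idx d) : t b e d e.swap = 0 := by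
  by_cases hbd : idx b = idx d
  · rcases eq_or_eq_swap_of_idx_eq hbd with rfl | rfl
    · exact ht.loop_self hg hbe
    · exact ht.loop_dual hg hbe
  · exact ht.loop_of_idx_ne hg hbd hbe hde

lemma eq_zero_of_free (ht : IsTreeSystem t) (hg : 4 ≤ g) {a b c d e : I g} (ha : idx e ≠ idx a)
    (hb : idx e ≠ idx b) (hc : idx e ≠ idx c) (hd : idx e ≠ idx d) : t a b c d = 0 := by
  have h := ht.contract_free ha hb hc hd
  rw [ht.loop_eq_zero hg hb hd, ht.loop_eq_zero hg hb hc, ht.loop_eq_zero hg ha hd,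
    ht.loop_eq_zero hg ha hc] at h
  simp only [smul_zero, sub_zero, add_zero] at h
  exact of_smul_sgn e h

lemma eq_zero_of_distinct (ht : IsTreeSystem t) {a b c d : I g} (hab : idx a ≠ idx b)
    (hac : idx a ≠ idx c) (had : idx a ≠ idx d) (hbc : idx b ≠ idx c) (hbd : idx b ≠ idx d) :
    t a b c d = 0 := by
  have h := ht.contract a b a.swap a c d
  rw [symp_self, symp_of_idx_ne hac, symp_of_idx_ne had, symp_of_idx_ne hab.symm,
    symp_of_idx_ne hbc, symp_of_idx_ne hbd, symp_swap_left,
    symp_of_idx_ne (a := a.swap) (b := c) (by rwa [idx_swap]),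
    symp_of_idx_ne (a := a.swap) (b := d) (by rwa [idx_swap])] at h
  simp only [zero_smul, zero_add, add_zero, neg_smul, neg_eq_zero] at h
  exact of_smul_sgn a h

theorem eq_zero (ht : IsTreeSystem t) (hg : 4 ≤ g) (a b c d : I g) : t a b c d = 0 := by
  by_cases hab : idx a = idx b
  · obtain ⟨e, h1, h2, h3⟩ := exists_idx_notMem hg (idx a) (idx c) (idx d)
    exact ht.eq_zero_of_free hg h1 (hab ▸ h1) h2 h3
  by_cases hac : idx a = idx c
  · obtain ⟨e, h1, h2, h3⟩ := exists_idx_notMem hg (idx a) (idx b) (idx d)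
    exact ht.eq_zero_of_free hg h1 h2 (hac ▸ h1) h3
  by_cases had : idx a = idx d
  · obtain ⟨e, h1, h2, h3⟩ := exists_idx_notMem hg (idx a) (idx b) (idx c)
    exact ht.eq_zero_of_free hg h1 h2 h3 (had ▸ h1)
  by_cases hbc : idx b = idx c
  · obtain ⟨e, h1, h2, h3⟩ := exists_idx_notMem hg (idx a) (idx b) (idx d)
    exact ht.eq_zero_of_free hg h1 h2 (hbc ▸ h2) h3
  by_cases hbd : idx b = idx d
  · obtain ⟨e, h1, h2, h3⟩ := exists_idx_notMem hg (idx a) (idx b) (idx c)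
    exact ht.eq_zero_of_free hg h1 h2 h3 (hbd ▸ h2)
  exact ht.eq_zero_of_distinct hab hac had hbc hbd

end IsTreeSystem

/-- the difference `[D₁, D₂]` of two tripod derivations, as an assignment on generators -/
noncomputable def tripodBracket (p : (I g × I g × I g) × (I g × I g × I g)) (j : I g) : L g :=
  freeDer (tripod p.1.1 p.1.2.1 p.1.2.2) (tripod p.2.1 p.2.2.1 p.2.2.2 j) -
    freeDer (tripod p.2.1 p.2.2.1 p.2.2.2) (tripod p.1.1 p.1.2.1 p.1.2.2 j)

theorem tree_mem_span_tripodBracket (hg : 4 ≤ g) (a b c d : I g) :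
    tree a b c d ∈ Submodule.span ℚ (Set.range (tripodBracket (g := g))) := by
  set B := Submodule.span ℚ (Set.range (tripodBracket (g := g)))
  have ht : IsTreeSystem fun a b c d : I g => B.mkQ (tree a b c d) :=
    { skew := fun a b c d => by rw [tree_skew_left, map_neg]
      symm := fun a b c d => by rw [tree_symm]
      ihx := fun a b c d => by rw [← map_add, ← map_add, tree_ihx, map_zero]
      contract := fun a₁ a₂ a₃ b₁ b₂ b₃ => by
        simp only [← map_smul, ← map_add]
        rw [Submodule.mkQ_apply, Submodule.Quotient.mk_eq_zero]
        refine Submodule.subset_span ⟨((a₁, a₂, a₃), (b₁, b₂, b₃)), ?_⟩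
        funext j
        exact bracket_tripod a₁ a₂ a₃ b₁ b₂ b₃ j }
  have h := ht.eq_zero hg a b c d
  rwa [Submodule.mkQ_apply, Submodule.Quotient.mk_eq_zero] at h

/-! ### Symplectic derivations of degree two are spanned by trees -/

/-- words in the noncommutative polynomial algebra -/
noncomputable def word (l : List (I g)) : MonoidAlgebra ℚ (FreeMonoid (I g)) :=
  MonoidAlgebra.single (FreeMonoid.ofList l) 1

lemma word_mul (l m : List (I g)) : word l * word m = word (l ++ m) := by
  simp [word, MonoidAlgebra.single_mul_single, FreeMonoid.ofList_append]

/-- the coefficient of a word -/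
noncomputable def wordCoeff (l : List (I g)) : MonoidAlgebra ℚ (FreeMonoid (I g)) →ₗ[ℚ] ℚ where
  toFun x := x.coeff (FreeMonoid.ofList l)
  map_add' _ _ := by simp
  map_smul' _ _ := by simp

lemma wordCoeff_word (l m : List (I g)) : wordCoeff l (word m) = if m = l then 1 else 0 := by
  classical
  change (word m).coeff (FreeMonoid.ofList l) = _
  rw [word, MonoidAlgebra.coeff_single, Finsupp.single_apply]
  exact if_congr FreeMonoid.ofList.injective.eq_iff rfl rfl

attribute [local instance] LieRing.ofAssociativeRing

/-- the embedding of the free Lie algebra in noncommutative polynomials -/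
noncomputable def toPoly : L g →ₗ⁅ℚ⁆ MonoidAlgebra ℚ (FreeMonoid (I g)) :=
  FreeLieAlgebra.lift ℚ fun i => word [i]

lemma toPoly_gen (i : I g) : toPoly (gen i) = word [i] := FreeLieAlgebra.lift_of_apply _ _

lemma toPoly_triple (p q r : I g) :
    toPoly ⁅gen p, ⁅gen q, gen r⁆⁆ =
      word [p, q, r] - word [p, r, q] - word [q, r, p] + word [r, q, p] := by
  simp only [LieHom.map_lie, toPoly_gen, LieRing.of_associative_ring_bracket, mul_sub, sub_mul,
    word_mul, List.cons_append, List.nil_append]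
  abel

/-- the coefficient of a word of length three in the image of a Lie polynomial -/
noncomputable def coeff₃ (b c d : I g) : L g →ₗ[ℚ] ℚ :=
  wordCoeff [b, c, d] ∘ₗ (toPoly : L g →ₗ⁅ℚ⁆ _).toLinearMap

lemma coeff₃_triple (b c d p q r : I g) :
    coeff₃ b c d ⁅gen p, ⁅gen q, gen r⁆⁆ =
      (if [p, q, r] = [b, c, d] then 1 else 0) - (if [p, r, q] = [b, c, d] then 1 else 0)
        - (if [q, r, p] = [b, c, d] then 1 else 0) + (if [r, q, p] = [b, c, d] then 1 else 0) := by
  change wordCoeff _ (toPoly _) = _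
  rw [toPoly_triple]
  simp only [map_add, map_sub, wordCoeff_word]

lemma range_iotaL_le : LS g 1 ≤ Submodule.span ℚ (Set.range (gen (g := g))) := by
  rintro _ ⟨u, rfl⟩
  rw [iotaL_apply]
  exact Submodule.sum_mem _ fun j _ => Submodule.smul_mem _ _ (Submodule.subset_span ⟨j, rfl⟩)

lemma gen_mem_LS (i : I g) : gen i ∈ LS g 1 := ⟨Pi.single i 1, iotaL_single i⟩

lemma lie_mem_LS {m : ℕ} (i : I g) {ξ : L g} (h : ξ ∈ LS g (m + 1)) : ⁅gen i, ξ⁆ ∈ LS g (m + 2) :=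
  Submodule.subset_span ⟨Pi.single i 1, ξ, h, by rw [iotaL_single]⟩

/-- the component of degree `m + 2` is spanned by brackets of generators with any spanning set
of the component of degree `m + 1` -/
lemma LS_add_two_le {m : ℕ} {S : Set (L g)} {P : Submodule ℚ (L g)}
    (hS : LS g (m + 1) ≤ Submodule.span ℚ S) (hP : ∀ i : I g, ∀ s ∈ S, ⁅gen i, s⁆ ∈ P) :
    LS g (m + 2) ≤ P := by
  refine Submodule.span_le.mpr ?_
  rintro _ ⟨u, ξ, hξ, rfl⟩
  rw [iotaL_apply, sum_lie]
  refine Submodule.sum_mem _ fun j _ => ?_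
  rw [smul_lie]
  refine Submodule.smul_mem _ _ ?_
  have : Submodule.span ℚ S ≤ P.comap (LieModule.toEnd ℚ (L g) (L g) (gen j)) :=
    Submodule.span_le.mpr fun s hs => hP j s hs
  exact this (hS hξ)

lemma LS_three_le {P : Submodule ℚ (L g)} (hP : ∀ p q r : I g, ⁅gen p, ⁅gen q, gen r⁆⁆ ∈ P) :
    LS g 3 ≤ P := by
  have h2 : LS g 2 ≤ Submodule.span ℚ (Set.range fun x : I g × I g => ⁅gen x.1, gen x.2⁆) := by
    refine LS_add_two_le range_iotaL_le ?_
    rintro i _ ⟨j, rfl⟩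
    exact Submodule.subset_span ⟨(i, j), rfl⟩
  refine LS_add_two_le h2 ?_
  rintro i _ ⟨⟨j, k⟩, rfl⟩
  exact hP i j k

/-- two linear maps which agree on triple brackets of generators agree on `L(3)` -/
lemma eq_of_mem_LS_three {V : Type*} [AddCommGroup V] [Module ℚ V] {φ ψ : L g →ₗ[ℚ] V}
    (h : ∀ p q r : I g, φ ⁅gen p, ⁅gen q, gen r⁆⁆ = ψ ⁅gen p, ⁅gen q, gen r⁆⁆)
    {ξ : L g} (hξ : ξ ∈ LS g 3) : φ ξ = ψ ξ :=
  LS_three_le (P := LinearMap.eqLocus φ ψ) h hξ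

lemma coeff₃_reverse (b c d : I g) {ξ : L g} (hξ : ξ ∈ LS g 3) :
    coeff₃ b c d ξ = coeff₃ d c b ξ := by
  refine eq_of_mem_LS_three (fun p q r => ?_) hξ
  simp only [coeff₃_triple, List.cons.injEq, and_true]
  simp only [and_comm, and_left_comm, and_assoc]
  ring

lemma wordCoeff_lie (a b c d e : I g) {ξ : L g} (hξ : ξ ∈ LS g 3) :
    wordCoeff [a, b, c, d] (toPoly ⁅gen e, ξ⁆) =
      (if e = a then coeff₃ b c d ξ else 0) - (if e = d then coeff₃ a b c ξ else 0) := by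
  let φ : L g →ₗ[ℚ] ℚ := wordCoeff [a, b, c, d] ∘ₗ (toPoly : L g →ₗ⁅ℚ⁆ _).toLinearMap ∘ₗ
    (LieModule.toEnd ℚ (L g) (L g) (gen e))
  let ψ : L g →ₗ[ℚ] ℚ := (if e = a then (1 : ℚ) else 0) • coeff₃ b c d -
    (if e = d then (1 : ℚ) else 0) • coeff₃ a b c
  have h : φ ξ = ψ ξ := by
    refine eq_of_mem_LS_three (fun p q r => ?_) hξ
    have h₁ : ∀ x y z : I g, (if [e, x, y, z] = [a, b, c, d] then (1 : ℚ) else 0) =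
        (if e = a then 1 else 0) * (if [x, y, z] = [b, c, d] then 1 else 0) := fun x y z => by
      by_cases h : e = a <;> simp [h]
    have h₂ : ∀ x y z : I g, (if [x, y, z, e] = [a, b, c, d] then (1 : ℚ) else 0) =
        (if e = d then 1 else 0) * (if [x, y, z] = [a, b, c] then 1 else 0) := fun x y z => by
      by_cases h : e = d <;> simp [h]
    change wordCoeff [a, b, c, d] (toPoly ⁅gen e, ⁅gen p, ⁅gen q, gen r⁆⁆⁆) =
      (if e = a then (1 : ℚ) else 0) * coeff₃ b c d ⁅gen p, ⁅gen q, gen r⁆⁆ -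
        (if e = d then (1 : ℚ) else 0) * coeff₃ a b c ⁅gen p, ⁅gen q, gen r⁆⁆
    rw [LieHom.map_lie, toPoly_triple, toPoly_gen, LieRing.of_associative_ring_bracket]
    simp only [mul_sub, mul_add, sub_mul, add_mul, word_mul, List.cons_append, List.nil_append,
      map_add, map_sub, wordCoeff_word, coeff₃_triple, h₁, h₂]
  have h' : wordCoeff [a, b, c, d] (toPoly ⁅gen e, ξ⁆) =
      (if e = a then (1 : ℚ) else 0) * coeff₃ b c d ξ -
        (if e = d then (1 : ℚ) else 0) * coeff₃ a b c ξ := h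
  rw [h']
  simp only [ite_mul, one_mul, zero_mul]

lemma three_smul_eq_sum {ξ : L g} (hξ : ξ ∈ LS g 3) :
    (3 : ℚ) • ξ = ∑ b : I g, ∑ c : I g, ∑ d : I g, coeff₃ b c d ξ • ⁅gen b, ⁅gen c, gen d⁆⁆ := by
  let ψ : L g →ₗ[ℚ] L g :=
    ∑ b : I g, ∑ c : I g, ∑ d : I g, (coeff₃ b c d).smulRight ⁅gen b, ⁅gen c, gen d⁆⁆
  have h : ((3 : ℚ) • (LinearMap.id : L g →ₗ[ℚ] L g)) ξ = ψ ξ := by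
    refine eq_of_mem_LS_three (fun p q r => ?_) hξ
    simp only [ψ, LinearMap.smul_apply, LinearMap.id_apply, LinearMap.sum_apply,
      LinearMap.smulRight_apply, coeff₃_triple, List.cons.injEq, and_true, sub_smul, add_smul,
      Finset.sum_add_distrib, Finset.sum_sub_distrib, ite_and, ite_smul, one_smul, zero_smul,
      Finset.sum_ite_eq, Finset.mem_univ, if_true, Finset.sum_ite_irrel, Finset.sum_const_zero]
    have := lie_jacobi (gen p) (gen q) (gen r)
    rw [← lie_skew (gen r) (gen q), ← lie_skew (gen q) (gen p), lie_neg, lie_neg]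
    linear_combination (norm := module) this
  simpa [ψ, LinearMap.sum_apply] using h

/-- an assignment on generators extending to a derivation with values in `L(3)` and killing `ω₀`
is a linear combination of trees -/
theorem mem_span_tree {f : I g → L g} (hf : ∀ j, f j ∈ LS g 3)
    (h0 : ∑ a : I g, ⁅gen a, sgn a • f a.swap⁆ = 0) {B : Submodule ℚ (I g → L g)}
    (hB : ∀ a b c d, tree a b c d ∈ B) : f ∈ B := by
  set ξ : I g → L g := fun a => sgn a • f a.swap with hξ
  have hξ3 : ∀ a, ξ a ∈ LS g 3 := fun a => Submodule.smul_mem _ _ (hf _)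
  set t : I g → I g → I g → I g → ℚ := fun a b c d => coeff₃ b c d (ξ a) with ht
  have hrot : ∀ a b c d, t a b c d = t d a b c := by
    intro a b c d
    have h := congrArg (fun z => wordCoeff [a, b, c, d] (toPoly z)) h0
    simp only [map_sum, map_zero] at h
    rw [Finset.sum_congr rfl fun e _ => wordCoeff_lie a b c d e (hξ3 e)] at h
    simpa [sub_eq_zero] using h
  have hrev : ∀ a b c d, t a b c d = t a d c b := fun a b c d => coeff₃_reverse b c d (hξ3 a)
  let F : I g → I g → I g → I g → I g → L g := fun a b c d j =>
    symp a j • ⁅gen b, ⁅gen c, gen d⁆⁆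
  have hF : (3 : ℚ) • f = ∑ a : I g, ∑ b : I g, ∑ c : I g, ∑ d : I g, t a b c d • F a b c d := by
    funext j
    have hj : f j = ∑ a : I g, symp a j • ξ a := by
      rw [Finset.sum_eq_single j.swap]
      · rw [symp_swap_left, hξ]
        simp [sgn_swap, smul_smul, sgn_mul_self]
      · intro a _ h
        rw [symp, if_neg, zero_smul]
        rintro rfl
        simp at h
      · simp
    rw [Pi.smul_apply, hj, Finset.smul_sum]
    simp only [Finset.sum_apply]
    refine Finset.sum_congr rfl fun a _ => ?_
    rw [smul_comm, three_smul_eq_sum (hξ3 a)]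
    simp only [Finset.smul_sum, F, Pi.smul_apply, ht]
    exact Finset.sum_congr rfl fun b _ => Finset.sum_congr rfl fun c _ =>
      Finset.sum_congr rfl fun d _ => smul_comm _ _ _
  have hT : ∀ a b c d, tree a b c d = F a b c d + F b a d c + F c d a b + F d c b a := by
    intro a b c d
    funext j
    simp only [tree, F, Pi.add_apply, ← lie_skew (gen d) (gen c), ← lie_skew (gen b) (gen a),
      lie_neg]
    module
  have h12 : (12 : ℚ) • f =
      ∑ a : I g, ∑ b : I g, ∑ c : I g, ∑ d : I g, t a b c d • tree a b c d := by
    have e1 : ∀ a b c d, t a b c d = t b a d c := fun a b c d => by rw [hrev b, ← hrot]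
    have e2 : ∀ a b c d, t a b c d = t c d a b := fun a b c d => by rw [hrot, hrot]
    have e3 : ∀ a b c d, t a b c d = t d c b a := fun a b c d => by rw [e2, e1]
    let T : I g × I g × I g × I g → (I g → L g) := fun x => t x.1 x.2.1 x.2.2.1 x.2.2.2 •
      F x.1 x.2.1 x.2.2.1 x.2.2.2
    have hT₁ : ∑ x, T x = (3 : ℚ) • f := by simp only [hF, Fintype.sum_prod_type, T]
    have p1 : Function.Involutive fun x : I g × I g × I g × I g =>
      (x.2.1, x.1, x.2.2.2, x.2.2.1) := fun _ => rfl
    have p2 : Function.Involutive fun x : I g × I g × I g × I g =>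
      (x.2.2.1, x.2.2.2, x.1, x.2.1) := fun _ => rfl
    have p3 : Function.Involutive fun x : I g × I g × I g × I g =>
      (x.2.2.2, x.2.2.1, x.2.1, x.1) := fun _ => rfl
    have hsum : (12 : ℚ) • f = ∑ x, (T x + T (x.2.1, x.1, x.2.2.2, x.2.2.1) +
        T (x.2.2.1, x.2.2.2, x.1, x.2.1) + T (x.2.2.2, x.2.2.1, x.2.1, x.1)) := by
      rw [Finset.sum_add_distrib, Finset.sum_add_distrib, Finset.sum_add_distrib,
        p1.bijective.sum_comp T, p2.bijective.sum_comp T, p3.bijective.sum_comp T, hT₁]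
      module
    rw [hsum]
    simp only [Fintype.sum_prod_type, T]
    refine Finset.sum_congr rfl fun a _ => Finset.sum_congr rfl fun b _ =>
      Finset.sum_congr rfl fun c _ => Finset.sum_congr rfl fun d _ => ?_
    rw [hT, ← e1 a b, ← e2 a b, ← e3 a b, smul_add, smul_add, smul_add]
  have : f = (1 / 12 : ℚ) • ((12 : ℚ) • f) := by rw [smul_smul]; norm_num
  rw [this, h12]
  exact Submodule.smul_mem _ _ <| Submodule.sum_mem _ fun a _ => Submodule.sum_mem _ fun b _ =>
    Submodule.sum_mem _ fun c _ => Submodule.sum_mem _ fun d _ =>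
      Submodule.smul_mem _ _ (hB a b c d)

/-- the linear map `H → L(m)` with prescribed values on the basis -/
noncomputable def ofBasis {m : ℕ} (f : I g → LS g m) : H g →ₗ[ℚ] LS g m :=
  Fintype.linearCombination ℚ f

lemma ofBasis_coe {m : ℕ} (f : I g → LS g m) (d : LieDerivation ℚ (L g) (L g))
    (hd : ∀ j, d (gen j) = f j) (u : H g) : d (iotaL g u) = (ofBasis f u : L g) := by
  simp [ofBasis, Fintype.linearCombination_apply, iotaL_apply, hd]

lemma tripod_mem_LS (a b c j : I g) : tripod a b c j ∈ LS g 2 :=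
  Submodule.add_mem _ (Submodule.add_mem _ (Submodule.smul_mem _ _ (lie_mem_LS _ (gen_mem_LS _)))
    (Submodule.smul_mem _ _ (lie_mem_LS _ (gen_mem_LS _))))
    (Submodule.smul_mem _ _ (lie_mem_LS _ (gen_mem_LS _)))

/-- a tripod as a linear map `H → L(2)` -/
noncomputable def tripodMap (p : I g × I g × I g) : H g →ₗ[ℚ] LS g 2 :=
  ofBasis fun j => ⟨tripod p.1 p.2.1 p.2.2 j, tripod_mem_LS _ _ _ _⟩

/-- the derivation extending a tripod -/
noncomputable def tripodDer (p : I g × I g × I g) : LieDerivation ℚ (L g) (L g) :=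
  freeDer (tripod p.1 p.2.1 p.2.2)

lemma tripodDer_iotaL (p : I g × I g × I g) (u : H g) :
    tripodDer p (iotaL g u) = (tripodMap p u : L g) :=
  ofBasis_coe (fun j => ⟨tripod p.1 p.2.1 p.2.2 j, tripod_mem_LS _ _ _ _⟩) (tripodDer p)
    (fun j => freeDer_of (tripod p.1 p.2.1 p.2.2) j) u

lemma tripodBracket_eq (p : (I g × I g × I g) × (I g × I g × I g)) (j : I g) :
    tripodBracket p j = tripodDer p.1 (tripodDer p.2 (gen j)) -
      tripodDer p.2 (tripodDer p.1 (gen j)) := by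
  simp only [tripodBracket, tripodDer, freeDer_of]

end trees

/-- for `g ≥ 4`, every element of `𝔩_g(2)` is a finite sum of brackets
`[D₁,D₂]` of elements `D₁, D₂ ∈ 𝔩_g(1)`, where `[D₁,D₂](v) = D̃₁(D₂(v)) - D̃₂(D₁(v))` with
`D̃ᵢ` the unique derivation of `L` extending `Dᵢ`; i.e. the bracket map
`Λ²𝔩_g(1) → 𝔩_g(2)` is surjective. -/
theorem stmt18 (g : ℕ) (hg : 4 ≤ g) :
    ∀ E : H g →ₗ[ℚ] ↥(LS g 3), E ∈ lset g 2 →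
      ∃ (n : ℕ) (D₁ D₂ : Fin n → (H g →ₗ[ℚ] ↥(LS g 2)))
        (d₁ d₂ : Fin n → LieDerivation ℚ (L g) (L g)),
        (∀ i, D₁ i ∈ lset g 1) ∧ (∀ i, D₂ i ∈ lset g 1) ∧
        (∀ i, ∀ v : H g, d₁ i (iotaL g v) = (D₁ i v : L g)) ∧
        (∀ i, ∀ v : H g, d₂ i (iotaL g v) = (D₂ i v : L g)) ∧
        (∀ v : H g, (E v : L g) =
          ∑ i : Fin n, (d₁ i (D₂ i v : L g) - d₂ i (D₁ i v : L g))) := by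
  intro E hE
  obtain ⟨d, hd, hd0⟩ := hE
  have hmem : (fun j => d (gen j)) ∈ Submodule.span ℚ (Set.range (tripodBracket (g := g))) := by
    refine mem_span_tree (fun j => ?_) ?_ (tree_mem_span_tripodBracket hg)
    · rw [← iotaL_single, hd]
      exact (E _).2
    · rw [← der_om0L, hd0]
  obtain ⟨c, hc⟩ := (Submodule.mem_span_range_iff_exists_fun ℚ).mp hmem
  let σ := (Fintype.equivFin ((I g × I g × I g) × (I g × I g × I g))).symm
  refine ⟨_, fun i => c (σ i) • tripodMap (σ i).1, fun i => tripodMap (σ i).2,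
    fun i => c (σ i) • tripodDer (σ i).1, fun i => tripodDer (σ i).2, fun i => ?_, fun i => ?_,
    fun i v => ?_, fun i v => tripodDer_iotaL _ v, fun v => ?_⟩
  · refine ⟨c (σ i) • tripodDer (σ i).1, fun u => ?_, ?_⟩
    · simp [tripodDer_iotaL]
    · rw [LieDerivation.smul_apply, tripodDer, freeDer_tripod_om0L, smul_zero]
  · exact ⟨tripodDer (σ i).2, tripodDer_iotaL _, freeDer_tripod_om0L _ _ _⟩
  · simp [tripodDer_iotaL]
  · rw [← hd, iotaL_apply, map_sum]
    have hj : ∀ j, d (gen j) = ∑ i, c (σ i) • tripodBracket (σ i) j := by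
      intro j
      rw [Equiv.sum_comp σ (fun p => c p • tripodBracket p j)]
      simpa using (congrFun hc j).symm
    have hv : ∀ i, (c (σ i) • tripodDer (σ i).1) (tripodMap (σ i).2 v : L g) -
        tripodDer (σ i).2 ((c (σ i) • tripodMap (σ i).1) v : L g) =
        ∑ j : I g, v j • c (σ i) • tripodBracket (σ i) j := by
      intro i
      simp only [LinearMap.smul_apply, SetLike.val_smul, map_smul, LieDerivation.smul_apply,
        ← tripodDer_iotaL, iotaL_apply, map_sum, tripodBracket_eq, Finset.smul_sum, smul_sub,
        Finset.sum_sub_distrib, smul_comm (v _) (c (σ i))]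
    simp only [hv, map_smul, hj, Finset.smul_sum]
    exact Finset.sum_comm
end
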